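/- arXiv:1711.10613 — 15 statements merged into one kernel-verified Lean document; each statement's English description precedes it below -/
import Mathlib

section
/- If L : ℝ → Mat_n(ℂ) is differentiable and satisfies the Lax equation L'(t) = A(t)L(t) − L(t)A(t) for a matrix-valued function A, then for every natural number k the function t ↦ trace((L(t))^k) is constant on ℝ. -/
/-- Entrywise product rule for matrix-valued functions. -/
theorem hasDerivAt_matrix_mul_apply {l m n : Type*} [Fintype m]
    {M : ℝ → Matrix l m ℂ} {N : ℝ → Matrix m n ℂ} {M' : Matrix l m ℂ} {N' : Matrix m n ℂ} {t : ℝ}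
    (hM : ∀ i j, HasDerivAt (fun s => M s i j) (M' i j) t)
    (hN : ∀ i j, HasDerivAt (fun s => N s i j) (N' i j) t) (i : l) (j : n) :
    HasDerivAt (fun s => (M s * N s) i j) ((M' * N t + M t * N') i j) t := by
  simp only [Matrix.add_apply, Matrix.mul_apply, ← Finset.sum_add_distrib]
  exact HasDerivAt.fun_sum fun x _ => (hM i x).mul (hN x j)

/-- Powers of a solution of the Lax equation again solve it. -/
theorem hasDerivAt_pow_apply_of_lax {ι : Type*} [Fintype ι] [DecidableEq ι]
    {L : ℝ → Matrix ι ι ℂ} {B : Matrix ι ι ℂ} {t : ℝ}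
    (hL : ∀ i j, HasDerivAt (fun s => L s i j) ((B * L t - L t * B) i j) t) (k : ℕ) (i j : ι) :
    HasDerivAt (fun s => (L s ^ k) i j) ((B * L t ^ k - L t ^ k * B) i j) t := by
  induction k generalizing i j with
  | zero => simpa using hasDerivAt_const t ((1 : Matrix ι ι ℂ) i j)
  | succ k ih =>
    have h := hasDerivAt_matrix_mul_apply ih hL i j
    simp only [pow_succ]
    have e : B * (L t ^ k * L t) - L t ^ k * L t * B =
        (B * L t ^ k - L t ^ k * B) * L t + L t ^ k * (B * L t - L t * B) := by
      noncomm_ring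
    rwa [e]

/-- If `L` satisfies the Lax equation `L' = A L - L A` (entrywise), then for every natural
number `k` the function `t ↦ trace (L t ^ k)` is constant on `ℝ`. -/
theorem stmt_1 {n : ℕ} (L A : ℝ → Matrix (Fin n) (Fin n) ℂ)
    (hL : ∀ (t : ℝ) (i j : Fin n),
      HasDerivAt (fun s => L s i j) ((A t * L t - L t * A t) i j) t) :
    ∀ (k : ℕ) (t₁ t₂ : ℝ), Matrix.trace (L t₁ ^ k) = Matrix.trace (L t₂ ^ k) := by
  intro k
  have h (t : ℝ) : HasDerivAt (fun s => Matrix.trace (L s ^ k)) 0 t := by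
    have hsum : HasDerivAt (fun s => Matrix.trace (L s ^ k))
        (Matrix.trace (A t * L t ^ k - L t ^ k * A t)) t :=
      HasDerivAt.fun_sum fun i _ => hasDerivAt_pow_apply_of_lax (hL t) k i i
    rwa [Matrix.trace_sub, Matrix.trace_mul_comm, sub_self] at hsum
  exact is_const_of_deriv_eq_zero (fun t => (h t).differentiableAt) fun t => (h t).deriv
end

section
/- If L : ℝ → Mat_n(ℂ) is differentiable and satisfies the Lax equation L'(t) = A(t)L(t) − L(t)A(t) for a matrix-valued function A, then the characteristic polynomial of L(t) (the polynomial det(μ·1 − L(t)) in μ) is the same for all t; equivalently, each coefficient of the characteristic polynomial is an integral of motion. -/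
/-- Jacobi's formula for the derivative of a determinant, for entrywise differentiable curves of
matrices. -/
theorem hasDerivAt_det_of_entries {ι : Type*} [Fintype ι] [DecidableEq ι]
    {M : ℝ → Matrix ι ι ℂ} {M' : Matrix ι ι ℂ} {t : ℝ}
    (hM : ∀ i j, HasDerivAt (fun s => M s i j) (M' i j) t) :
    HasDerivAt (fun s => (M s).det) ((M t).adjugate * M').trace t := by
  have key : ((M t).adjugate * M').trace = ∑ σ : Equiv.Perm ι, ((Equiv.Perm.sign σ : ℤ) : ℂ) *
      ∑ i, (∏ j ∈ Finset.univ.erase i, M t (σ j) j) • M' (σ i) i := by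
    have hcol (i : ι) : ((M t).adjugate * M') i i = ((M t).updateCol i (fun k => M' k i)).det := by
      rw [← Matrix.cramer_apply, Matrix.cramer_eq_adjugate_mulVec]
      rfl
    simp only [Matrix.trace, Matrix.diag_apply, hcol, Matrix.det_apply', Finset.mul_sum]
    rw [Finset.sum_comm]
    refine Finset.sum_congr rfl fun σ _ => Finset.sum_congr rfl fun i _ => ?_
    rw [← Finset.prod_erase_mul _ _ (Finset.mem_univ i), Matrix.updateCol_self, smul_eq_mul]
    congr 2
    refine Finset.prod_congr rfl fun j hj => ?_
    rw [Matrix.updateCol_ne (Finset.ne_of_mem_erase hj)]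
  rw [key]
  simp only [Matrix.det_apply']
  exact HasDerivAt.fun_sum fun σ _ =>
    (HasDerivAt.fun_finsetProd fun i _ => hM (σ i) i).const_mul _

/-- The adjugate of `M` is trace-orthogonal to every commutator with `M`. -/
theorem Matrix.trace_adjugate_mul_commutator {ι R : Type*} [Fintype ι] [DecidableEq ι] [CommRing R]
    (M A : Matrix ι ι R) : (M.adjugate * (A * M - M * A)).trace = 0 := by
  rw [mul_sub, Matrix.trace_sub, ← mul_assoc, Matrix.trace_mul_comm, ← mul_assoc, ← mul_assoc,
    Matrix.mul_adjugate, Matrix.adjugate_mul, sub_self]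

/-- If `L` satisfies the Lax equation `L' = A L - L A` (entrywise), then the characteristic
polynomial of `L t` is the same for all `t`. -/
theorem stmt_2 {n : ℕ} (L A : ℝ → Matrix (Fin n) (Fin n) ℂ)
    (hL : ∀ (t : ℝ) (i j : Fin n),
      HasDerivAt (fun s => L s i j) ((A t * L t - L t * A t) i j) t) :
    ∀ t₁ t₂ : ℝ, (L t₁).charpoly = (L t₂).charpoly := by
  intro t₁ t₂
  refine Polynomial.funext fun μ => ?_
  simp only [Matrix.eval_charpoly]
  have hdet (t : ℝ) : HasDerivAt (fun s => (Matrix.scalar (Fin n) μ - L s).det) 0 t := by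
    have hcomm : A t * (Matrix.scalar (Fin n) μ - L t) - (Matrix.scalar (Fin n) μ - L t) * A t
        = -(A t * L t - L t * A t) := by
      rw [mul_sub, sub_mul, (Matrix.scalar_commute μ (Commute.all μ) (A t)).eq]
      abel
    rw [← Matrix.trace_adjugate_mul_commutator (Matrix.scalar (Fin n) μ - L t) (A t), hcomm]
    exact hasDerivAt_det_of_entries fun i j => (hL t i j).const_sub _
  exact is_const_of_deriv_eq_zero (fun t => (hdet t).differentiableAt) (fun t => (hdet t).deriv)
    t₁ t₂
end

section
/- Let {·,·}₁ and {·,·}₂ be compatible Poisson brackets on a commutative ℂ-algebra A, and suppose C(λ) = C₀ + λC₁ + ⋯ + λⁿCₙ (with C₀,…,Cₙ ∈ A) is a Casimir function of the pencil {·,·}₁ + λ{·,·}₂ for all λ ∈ ℂ; equivalently, {C₀, f}₁ = 0, {Cₖ, f}₁ + {Cₖ₋₁, f}₂ = 0 for 1 ≤ k ≤ n, and {Cₙ, f}₂ = 0, for every f ∈ A. Then the coefficients commute with each other with respect to both brackets: {Cᵢ, Cⱼ}₁ = 0 and {Cᵢ, Cⱼ}₂ = 0 for all 0 ≤ i, j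 ≤ n. -/
/-- Magri's theorem: if `C(λ) = C₀ + λC₁ + ⋯ + λⁿCₙ` is a Casimir function of the pencil of
two compatible Poisson brackets on a commutative ℂ-algebra, then the coefficients `Cᵢ`
pairwise commute with respect to both brackets. -/
theorem stmt_3 {A : Type*} [CommRing A] [Algebra ℂ A]
    (P₁ P₂ : A →ₗ[ℂ] A →ₗ[ℂ] A)
    (skew₁ : ∀ a b : A, P₁ a b = - P₁ b a)
    (skew₂ : ∀ a b : A, P₂ a b = - P₂ b a)
    (leib₁ : ∀ a b c : A, P₁ a (b * c) = P₁ a b * c + b * P₁ a c)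
    (leib₂ : ∀ a b c : A, P₂ a (b * c) = P₂ a b * c + b * P₂ a c)
    -- the pencil `{·,·}₁ + λ{·,·}₂` satisfies the Jacobi identity for every `λ ∈ ℂ`
    (jacobi : ∀ (lam : ℂ) (a b c : A),
      (P₁ (P₁ a b + lam • P₂ a b) c + lam • P₂ (P₁ a b + lam • P₂ a b) c) +
      (P₁ (P₁ b c + lam • P₂ b c) a + lam • P₂ (P₁ b c + lam • P₂ b c) a) +
      (P₁ (P₁ c a + lam • P₂ c a) b + lam • P₂ (P₁ c a + lam • P₂ c a) b) = 0)
    (n : ℕ) (C : ℕ → A)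
    (hC0 : ∀ f : A, P₁ (C 0) f = 0)
    (hCk : ∀ k : ℕ, 1 ≤ k → k ≤ n → ∀ f : A, P₁ (C k) f + P₂ (C (k - 1)) f = 0)
    (hCn : ∀ f : A, P₂ (C n) f = 0) :
    ∀ i j : ℕ, i ≤ n → j ≤ n → P₁ (C i) (C j) = 0 ∧ P₂ (C i) (C j) = 0 := by
  have shift : ∀ k < n, ∀ f : A, P₂ (C k) f = -P₁ (C (k + 1)) f := fun k hk f =>
    eq_neg_of_add_eq_zero_right (by simpa using hCk (k + 1) (by omega) (by omega) f)
  have comm₁ : ∀ i ≤ n, ∀ j ≤ n, P₁ (C i) (C j) = 0 := by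
    intro i
    induction i with
    | zero => exact fun _ j _ => hC0 (C j)
    | succ i ih =>
      intro hi j hj
      have h : P₁ (C (i + 1)) (C j) = P₂ (C j) (C i) := by
        rw [skew₂, shift i hi, neg_neg]
      rw [h]
      rcases hj.eq_or_lt with rfl | hlt
      · exact hCn _
      · rw [shift j hlt, ← skew₁]
        exact ih (by omega) (j + 1) hlt
  intro i j hi hj
  refine ⟨comm₁ i hi j hj, ?_⟩
  rcases hi.eq_or_lt with rfl | hlt
  · exact hCn _
  · rw [shift i hlt, comm₁ (i + 1) hlt j hj, neg_zero]
end

section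
/- Let Q = Σ_{|I| ≤ m} a_I ∂^I be a linear differential operator of order m on polynomials in N variables, where the sum is over multi-indices I = (i₁,…,i_N) with i₁+⋯+i_N ≤ m, each coefficient a_I is a polynomial in ℂ[y₁,…,y_N], and ∂^I denotes the iterated partial derivative ∂_{y₁}^{i₁}⋯∂_{y_N}^{i_N}. If Q is quasi-solvable, i.e. there exists k ≥ m such that Q maps every polynomial of total degree ≤ k to a polynomial of total degree ≤ k, then for every multi-index I the total degree of the coefficient a_I satisfies deg(a_I) ≤ m + i₁ + ⋯ + i_N. -/
/-- The iterated formal partial derivative `∂^I = ∂_{y₁}^{i₁} ⋯ ∂_{y_N}^{i_N}` associated to a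
multi-index `I` (partial derivatives commute, so the order of the folds is irrelevant). -/
noncomputable def iterPD {N : ℕ} (I : Fin N → ℕ) (p : MvPolynomial (Fin N) ℂ) :
    MvPolynomial (Fin N) ℂ :=
  (List.finRange N).foldr (fun i q => (⇑(MvPolynomial.pderiv (R := ℂ) i))^[I i] q) p

open MvPolynomial

section LinearForm

variable {N : ℕ}

/-- The linear form `∑ ξ_i y_i`. -/
noncomputable def linForm (ξ : Fin N → ℂ) : MvPolynomial (Fin N) ℂ := ∑ i, C (ξ i) * X i

lemma pderiv_linForm (ξ : Fin N → ℂ) (i : Fin N) : pderiv i (linForm ξ) = C (ξ i) := by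
  simp [linForm, pderiv_X, Pi.single_apply]

lemma linForm_isHomogeneous (ξ : Fin N → ℂ) : (linForm ξ).IsHomogeneous 1 :=
  IsHomogeneous.sum _ _ _ fun i _ => by
    simpa using (isHomogeneous_C (Fin N) (ξ i)).mul (isHomogeneous_X ℂ i)

lemma linForm_ne_zero {ξ : Fin N → ℂ} {i : Fin N} (h : ξ i ≠ 0) : linForm ξ ≠ 0 := fun h0 => h <| by
  have := pderiv_linForm ξ i
  rw [h0, map_zero] at this
  exact (C_eq_zero.mp this.symm)

lemma iterate_pderiv_linForm_pow (ξ : Fin N → ℂ) (i : Fin N) (c : ℂ) (j n : ℕ) :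
    (⇑(pderiv (R := ℂ) i))^[n] (C c * linForm ξ ^ j) =
      C (c * j.descFactorial n * ξ i ^ n) * linForm ξ ^ (j - n) := by
  induction n with
  | zero => simp
  | succ n ih =>
    rw [Function.iterate_succ_apply', ih, pderiv_C_mul, pderiv_pow, pderiv_linForm,
      Nat.descFactorial_succ, Nat.sub_sub]
    simp only [map_mul, map_pow, Nat.cast_mul, map_natCast]
    ring

lemma foldr_pderiv_linForm_pow (ξ : Fin N → ℂ) (I : Fin N → ℕ) (j : ℕ) (L : List (Fin N)) :
    L.foldr (fun i q => (⇑(pderiv (R := ℂ) i))^[I i] q) (linForm ξ ^ j) =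
      C (j.descFactorial (L.map I).sum * (L.map fun i => ξ i ^ I i).prod) *
        linForm ξ ^ (j - (L.map I).sum) := by
  induction L with
  | nil => simp
  | cons i L ih =>
    rw [List.foldr_cons, ih, iterate_pderiv_linForm_pow]
    have h := Nat.descFactorial_mul_descFactorial (n := j)
      (Nat.le_add_left (L.map I).sum (I i))
    rw [Nat.add_sub_cancel] at h
    simp only [List.map_cons, List.sum_cons, List.prod_cons]
    rw [← h, Nat.sub_sub, Nat.add_comm (I i)]
    congr 2
    push_cast
    ring

lemma iterPD_linForm_pow (ξ : Fin N → ℂ) (I : Fin N → ℕ) (j : ℕ) :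
    iterPD I (linForm ξ ^ j) =
      C (j.descFactorial (∑ i, I i) * ∏ i, ξ i ^ I i) * linForm ξ ^ (j - ∑ i, I i) := by
  rw [iterPD, foldr_pderiv_linForm_pow, Fin.sum_univ_def, Fin.prod_univ_def]

/-- The falling factorials of degree at most `m` are independent as functions on any `m + 1`
consecutive natural numbers. -/
lemma eq_zero_of_sum_descFactorial {m k : ℕ} (hk : m ≤ k) (w : ℕ → ℂ)
    (h : ∀ j, k - m ≤ j → j ≤ k → ∑ r ∈ Finset.range (m + 1), (j.descFactorial r : ℂ) * w r = 0) :
    ∀ r ≤ m, w r = 0 := by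
  set P : Polynomial ℂ := ∑ r ∈ Finset.range (m + 1), Polynomial.C (w r) * descPochhammer ℂ r
  have heval (j : ℕ) : P.eval (j : ℂ) =
      ∑ r ∈ Finset.range (m + 1), (j.descFactorial r : ℂ) * w r := by
    simp [P, Polynomial.eval_finsetSum, descPochhammer_eval_eq_descFactorial, mul_comm]
  have hdeg : P.degree < (m + 1 : ℕ) := by
    refine (Polynomial.degree_sum_le _ _).trans_lt ?_
    rw [Finset.sup_lt_iff (WithBot.bot_lt_coe _)]
    intro r hr
    refine Polynomial.degree_le_natDegree.trans_lt (Nat.cast_lt.mpr ?_)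
    refine (Polynomial.natDegree_C_mul_le _ _).trans_lt ?_
    rw [descPochhammer_natDegree]
    exact Finset.mem_range.mp hr
  have hP : P = 0 := by
    refine Polynomial.eq_zero_of_degree_lt_of_eval_finset_eq_zero
      ((Finset.Icc (k - m) k).map Nat.castEmbedding) ?_ ?_
    · rw [Finset.card_map, Nat.card_Icc]
      convert hdeg using 2
      omega
    · simp only [Finset.mem_map, Finset.mem_Icc, Nat.castEmbedding_apply]
      rintro _ ⟨j, ⟨h1, h2⟩, rfl⟩
      rw [heval, h j h1 h2]
  intro r
  induction r using Nat.strong_induction_on with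
  | _ r ih =>
    intro hr
    have h0 := heval r
    rw [hP, Polynomial.eval_zero, Finset.sum_eq_single r] at h0
    · simpa [Nat.descFactorial_self, Nat.factorial_ne_zero] using h0.symm
    · intro s hs hsr
      rcases hsr.lt_or_gt with hlt | hgt
      · rw [ih s hlt (by omega), mul_zero]
      · rw [Nat.descFactorial_of_lt hgt, Nat.cast_zero, zero_mul]
    · intro hn
      exact absurd (Finset.mem_range.mpr (by omega)) hn

lemma totalDegree_le_of_coeff {σ : Type*} {p : MvPolynomial σ ℂ} {d : ℕ}
    (h : ∀ J : σ →₀ ℕ, d < J.degree → p.coeff J = 0) : p.totalDegree ≤ d := by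
  refine Finset.sup_le fun J hJ => ?_
  by_contra! hlt
  exact mem_support_iff.mp hJ (h J hlt)

lemma coeff_eq_zero_of_totalDegree_lt_degree {σ : Type*} {p : MvPolynomial σ ℂ} {J : σ →₀ ℕ}
    (h : p.totalDegree < J.degree) : p.coeff J = 0 :=
  coeff_eq_zero_of_totalDegree_lt h

/-- The part of order `r` of the symbol of `∑ I ∈ S, a I * iterPD I`, evaluated at the covector
`ξ`. -/
noncomputable def symbolPart (S : Finset (Fin N → ℕ))
    (a : (Fin N → ℕ) → MvPolynomial (Fin N) ℂ) (ξ : Fin N → ℂ) (r : ℕ) : MvPolynomial (Fin N) ℂ :=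
  ∑ I ∈ S with ∑ i, I i = r, C (∏ i, ξ i ^ I i) * a I

lemma linForm_pow_mul_apply {m k j : ℕ} (hj : j ≤ k) (S : Finset (Fin N → ℕ))
    (a : (Fin N → ℕ) → MvPolynomial (Fin N) ℂ) (hS : ∀ I ∈ S, ∑ i, I i ≤ m) (ξ : Fin N → ℂ) :
    linForm ξ ^ (k - j) * ∑ I ∈ S, a I * iterPD I (linForm ξ ^ j) =
      ∑ r ∈ Finset.range (m + 1),
        C (j.descFactorial r : ℂ) * (symbolPart S a ξ r * linForm ξ ^ (k - r)) := by
  rw [← Finset.sum_fiberwise_of_maps_to (g := fun I => ∑ i, I i) (t := Finset.range (m + 1))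
    fun I hI => Finset.mem_range.mpr (Nat.lt_succ_of_le (hS I hI)), Finset.mul_sum]
  refine Finset.sum_congr rfl fun r _ => ?_
  rw [symbolPart, Finset.sum_mul, Finset.mul_sum, Finset.mul_sum]
  refine Finset.sum_congr rfl fun I hI => ?_
  obtain rfl := (Finset.mem_filter.mp hI).2
  rw [iterPD_linForm_pow]
  rcases le_or_gt (∑ i, I i) j with h | h
  · rw [show k - ∑ i, I i = (k - j) + (j - ∑ i, I i) by omega, pow_add, C_mul]
    ring
  · simp [Nat.descFactorial_of_lt h]

lemma totalDegree_symbolPart_le {m k : ℕ} (hk : m ≤ k) (S : Finset (Fin N → ℕ))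
    (a : (Fin N → ℕ) → MvPolynomial (Fin N) ℂ) (hS : ∀ I ∈ S, ∑ i, I i ≤ m)
    (hq : ∀ p : MvPolynomial (Fin N) ℂ, p.totalDegree ≤ k →
      (∑ I ∈ S, a I * iterPD I p).totalDegree ≤ k)
    {ξ : Fin N → ℂ} {i : Fin N} (hξ : ξ i ≠ 0) {r : ℕ} (hr : r ≤ m) :
    (symbolPart S a ξ r).totalDegree ≤ m + r := by
  have ht := linForm_ne_zero hξ
  have hpow (n : ℕ) : (linForm ξ ^ n).totalDegree = n := by
    simpa using ((linForm_isHomogeneous ξ).pow n).totalDegree (pow_ne_zero n ht)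
  have key : (symbolPart S a ξ r * linForm ξ ^ (k - r)).totalDegree ≤ k + m := by
    refine totalDegree_le_of_coeff fun J hJ => ?_
    refine eq_zero_of_sum_descFactorial hk
      (fun r => (symbolPart S a ξ r * linForm ξ ^ (k - r)).coeff J) (fun j h1 h2 => ?_) r hr
    have hdeg : (linForm ξ ^ (k - j) * ∑ I ∈ S, a I * iterPD I (linForm ξ ^ j)).totalDegree
        < J.degree := by
      have := hq (linForm ξ ^ j) ((hpow j).trans_le h2)
      have := totalDegree_mul (linForm ξ ^ (k - j)) (∑ I ∈ S, a I * iterPD I (linForm ξ ^ j))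
      rw [hpow] at this
      omega
    have h0 := coeff_eq_zero_of_totalDegree_lt_degree hdeg
    rw [linForm_pow_mul_apply h2 S a hS, coeff_sum] at h0
    simpa only [coeff_C_mul] using h0
  rcases eq_or_ne (symbolPart S a ξ r) 0 with h0 | h0
  · simp [h0]
  · rw [totalDegree_mul_of_isDomain h0 (pow_ne_zero _ ht), hpow] at key
    omega

end LinearForm

/-- If a linear differential operator `Q = Σ_{|I| ≤ m} a_I ∂^I` of order `m` with polynomial
coefficients is quasi-solvable (preserves polynomials of total degree ≤ k for some `k ≥ m`),
then `deg a_I ≤ m + i₁ + ⋯ + i_N` for every multi-index `I`. -/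
theorem stmt_5 {N m : ℕ} (S : Finset (Fin N → ℕ))
    (a : (Fin N → ℕ) → MvPolynomial (Fin N) ℂ)
    (hS : ∀ I ∈ S, ∑ i, I i ≤ m)
    (hq : ∃ k : ℕ, m ≤ k ∧ ∀ p : MvPolynomial (Fin N) ℂ, p.totalDegree ≤ k →
      (∑ I ∈ S, a I * iterPD I p).totalDegree ≤ k) :
    ∀ I ∈ S, (a I).totalDegree ≤ m + ∑ i, I i := by
  obtain ⟨k, hk, hq⟩ := hq
  intro I₀ hI₀
  rcases isEmpty_or_nonempty (Fin N) with _ | ⟨⟨i₀⟩⟩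
  · rw [totalDegree_eq_zero_iff_eq_C.mpr (eq_C_of_isEmpty _)]
    exact Nat.zero_le _
  refine totalDegree_le_of_coeff fun J hJ => ?_
  set T := S.filter fun I => ∑ i, I i = ∑ i, I₀ i
  set f : MvPolynomial (Fin N) ℂ :=
    ∑ I ∈ T, monomial (Finsupp.equivFunOnFinite.symm I) ((a I).coeff J)
  have hf : X i₀ * f = 0 := by
    refine MvPolynomial.funext fun ξ => ?_
    rw [map_mul, eval_X, map_zero, mul_eq_zero, or_iff_not_imp_left]
    intro hξ
    have h0 := coeff_eq_zero_of_totalDegree_lt_degree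
      ((totalDegree_symbolPart_le hk S a hS hq hξ (hS I₀ hI₀)).trans_lt hJ)
    rw [symbolPart, coeff_sum] at h0
    rw [← h0, map_sum]
    refine Finset.sum_congr rfl fun I _ => ?_
    rw [eval_monomial, coeff_C_mul, mul_comm, Finsupp.prod_fintype _ _ fun i => pow_zero _]
    rfl
  have hc : f.coeff (Finsupp.equivFunOnFinite.symm I₀) = (a I₀).coeff J := by
    have hmem : I₀ ∈ T := Finset.mem_filter.mpr ⟨hI₀, rfl⟩
    simp only [f, coeff_sum, coeff_monomial, EmbeddingLike.apply_eq_iff_eq]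
    rw [Finset.sum_ite_eq' T I₀, if_pos hmem]
  rw [← hc, (mul_eq_zero.mp hf).resolve_left (X_ne_zero i₀), coeff_zero]
end

section
/- Let a, b, c ∈ ℂ[x] and let k ≥ 2 be an integer such that the second-order operator P(p) = a·p'' + b·p' + c·p maps every polynomial p of degree ≤ k to a polynomial of degree ≤ k. Then deg a ≤ 4, deg b ≤ 3, deg c ≤ 2, and writing aᵢ, bᵢ, cᵢ for the coefficients of xⁱ, the following relations hold: b₃ = 2(1−k)·a₄, c₂ = k(k−1)·a₄, and c₁ = k(a₃ − k·a₃ − b₂). -/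
open Polynomial

/-- The coefficient of `x^(j+m)` in the image of `x^j` under the operator with coefficients `a`, `b`,
`c`. -/
theorem coeff_operator_X_pow {R : Type*} [CommRing R] (a b c : R[X]) (j m : ℕ) :
    (a * derivative (derivative (X ^ j)) + b * derivative (X ^ j) + c * X ^ j).coeff (j + m) =
      (j : R) * ((j : R) - 1) * a.coeff (m + 2) + (j : R) * b.coeff (m + 1) + c.coeff m := by
  have hc : (c * X ^ j).coeff (j + m) = c.coeff m := by
    rw [add_comm, coeff_mul_X_pow]
  have hb : (b * derivative (X ^ j)).coeff (j + m) = (j : R) * b.coeff (m + 1) := by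
    rcases j with _ | j
    · simp
    · rw [derivative_X_pow, mul_left_comm, coeff_C_mul, Nat.add_sub_cancel,
        show j + 1 + m = (m + 1) + j by ring, coeff_mul_X_pow]
  have ha : (a * derivative (derivative (X ^ j))).coeff (j + m) =
      (j : R) * ((j : R) - 1) * a.coeff (m + 2) := by
    rcases j with _ | _ | j
    · simp
    · simp
    · rw [derivative_X_pow, derivative_C_mul, Nat.add_sub_cancel, derivative_X_pow,
        Nat.add_sub_cancel, mul_left_comm, coeff_C_mul, mul_left_comm, coeff_C_mul,
        show j + 1 + 1 + m = (m + 2) + j by ring, coeff_mul_X_pow]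
      push_cast
      ring
  rw [coeff_add, coeff_add, ha, hb, hc]

/-- Structure of quasi-solvable second order operators in one variable: if
`P(p) = a p'' + b p' + c p` maps every polynomial of degree ≤ k (k ≥ 2) to a polynomial of
degree ≤ k, then `deg a ≤ 4`, `deg b ≤ 3`, `deg c ≤ 2` and
`b₃ = 2(1−k)a₄`, `c₂ = k(k−1)a₄`, `c₁ = k(a₃ − k a₃ − b₂)`. -/
theorem stmt_6 (a b c : Polynomial ℂ) (k : ℕ) (hk : 2 ≤ k)
    (h : ∀ p : Polynomial ℂ, p.natDegree ≤ k →
      (a * derivative (derivative p) + b * derivative p + c * p).natDegree ≤ k) :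
    a.natDegree ≤ 4 ∧ b.natDegree ≤ 3 ∧ c.natDegree ≤ 2 ∧
    b.coeff 3 = 2 * (1 - (k : ℂ)) * a.coeff 4 ∧
    c.coeff 2 = (k : ℂ) * ((k : ℂ) - 1) * a.coeff 4 ∧
    c.coeff 1 = (k : ℂ) * (a.coeff 3 - (k : ℂ) * a.coeff 3 - b.coeff 2) := by
  have key (j m : ℕ) (hj : j ≤ k) (hm : k < j + m) :
      (j : ℂ) * ((j : ℂ) - 1) * a.coeff (m + 2) + (j : ℂ) * b.coeff (m + 1) + c.coeff m = 0 := by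
    rw [← coeff_operator_X_pow]
    exact coeff_eq_zero_of_natDegree_lt
      ((h (X ^ j) (by rwa [natDegree_X_pow])).trans_lt hm)
  obtain ⟨n, rfl⟩ := Nat.exists_eq_add_of_le' hk
  have high (m : ℕ) (hm : 3 ≤ m) :
      a.coeff (m + 2) = 0 ∧ b.coeff (m + 1) = 0 ∧ c.coeff m = 0 := by
    have h₀ := key n m (by omega) (by omega)
    have h₁ := key (n + 1) m (by omega) (by omega)
    have h₂ := key (n + 2) m (by omega) (by omega)
    push_cast at h₁ h₂
    have ha : a.coeff (m + 2) = 0 := by linear_combination (h₂ - 2 * h₁ + h₀) / 2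
    have hb : b.coeff (m + 1) = 0 := by linear_combination h₁ - h₀ - 2 * n * ha
    refine ⟨ha, hb, ?_⟩
    linear_combination h₀ - n * (n - 1) * ha - n * hb
  have h₁ := key (n + 1) 2 (by omega) (by omega)
  have h₂ := key (n + 2) 2 (by omega) (by omega)
  have h₃ := key (n + 2) 1 (by omega) (by omega)
  push_cast at h₁ h₂ h₃ ⊢
  norm_num at h₁ h₂ h₃
  refine ⟨natDegree_le_iff_coeff_eq_zero.mpr fun N hN => ?_,
    natDegree_le_iff_coeff_eq_zero.mpr fun N hN => ?_,
    natDegree_le_iff_coeff_eq_zero.mpr fun N hN => (high N hN).2.2, ?_, ?_, ?_⟩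
  · obtain ⟨m, rfl⟩ := Nat.exists_eq_add_of_le' (show 2 ≤ N by omega)
    exact (high m (by omega)).1
  · obtain ⟨m, rfl⟩ := Nat.exists_eq_add_of_le' (show 1 ≤ N by omega)
    exact (high m (by omega)).2.1
  · linear_combination h₂ - h₁
  · linear_combination (n + 2) * h₁ - (n + 1) * h₂
  · linear_combination h₃
end

section
/- Let G = G₀ ⊕ G₁ be a ℤ₂-graded Lie algebra over ℂ and R : G₁ → G₀ a linear map. Then the subspace {m − R(m) : m ∈ G₁} is a Lie subalgebra of G if and only if R satisfies the modified Yang–Baxter equation: R(⁅R(X), Y⁆ − ⁅R(Y), X⁆) − ⁅R(X), R(Y)⁆ − ⁅X, Y⁆ = 0 for all X, Y ∈ G₁ (note ⁅R(X),Y⁆, ⁅R(Y),X⁆ ∈ G₁ and ⁅R(X),R(Y)⁆, ⁅X,Y⁆ ∈ G₀ by the grading). -/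
/-- Let `G = G₀ ⊕ G₁` be a ℤ₂-graded Lie algebra over ℂ and `R` a linear map sending `G₁`
into `G₀`. The subspace `{m − R m : m ∈ G₁}` is a Lie subalgebra of `G` iff `R` satisfies the
modified Yang–Baxter equation
`R(⁅R X, Y⁆ − ⁅R Y, X⁆) − ⁅R X, R Y⁆ − ⁅X, Y⁆ = 0` for all `X, Y ∈ G₁`. -/
theorem stmt_7 {G : Type*} [LieRing G] [LieAlgebra ℂ G]
    (G₀ G₁ : Submodule ℂ G)
    (hcompl : IsCompl G₀ G₁)
    (h00 : ∀ x ∈ G₀, ∀ y ∈ G₀, ⁅x, y⁆ ∈ G₀)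
    (h01 : ∀ x ∈ G₀, ∀ y ∈ G₁, ⁅x, y⁆ ∈ G₁)
    (h11 : ∀ x ∈ G₁, ∀ y ∈ G₁, ⁅x, y⁆ ∈ G₀)
    (R : G →ₗ[ℂ] G) (hR : ∀ x ∈ G₁, R x ∈ G₀) :
    (∀ x ∈ Submodule.map (LinearMap.id - R) G₁,
     ∀ y ∈ Submodule.map (LinearMap.id - R) G₁,
        ⁅x, y⁆ ∈ Submodule.map (LinearMap.id - R) G₁)
    ↔ (∀ X ∈ G₁, ∀ Y ∈ G₁,
        R ⁅R X, Y⁆ - R ⁅R Y, X⁆ - ⁅R X, R Y⁆ - ⁅X, Y⁆ = 0) := by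
  have key (X Y : G) : ⁅X - R X, Y - R Y⁆ =
      (⁅X, Y⁆ + ⁅R X, R Y⁆) - (⁅R X, Y⁆ - ⁅R Y, X⁆) := by
    rw [sub_lie, lie_sub, lie_sub, ← lie_skew X (R Y)]
    abel
  have hW {X Y : G} (hX : X ∈ G₁) (hY : Y ∈ G₁) : ⁅R X, Y⁆ - ⁅R Y, X⁆ ∈ G₁ :=
    G₁.sub_mem (h01 _ (hR X hX) _ hY) (h01 _ (hR Y hY) _ hX)
  constructor
  · intro h X hX Y hY
    obtain ⟨m, hm, hmeq⟩ := h _ (Submodule.mem_map_of_mem hX) _ (Submodule.mem_map_of_mem hY)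
    simp only [LinearMap.sub_apply, LinearMap.id_apply, key] at hmeq
    have hsum : m + (⁅R X, Y⁆ - ⁅R Y, X⁆) = (⁅X, Y⁆ + ⁅R X, R Y⁆) + R m := by
      rw [← sub_eq_sub_iff_add_eq_add]
      exact hmeq
    have hzero : m + (⁅R X, Y⁆ - ⁅R Y, X⁆) = 0 := by
      refine Submodule.disjoint_def.mp hcompl.disjoint _ ?_ (G₁.add_mem hm (hW hX hY))
      rw [hsum]
      exact G₀.add_mem (G₀.add_mem (h11 _ hX _ hY) (h00 _ (hR X hX) _ (hR Y hY))) (hR m hm)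
    have hRm : R m + (R ⁅R X, Y⁆ - R ⁅R Y, X⁆) = 0 := by
      rw [← map_sub, ← map_add, hzero, map_zero]
    rw [hzero] at hsum
    rw [eq_neg_of_add_eq_zero_right hRm, eq_neg_of_add_eq_zero_right hsum.symm]
    abel
  · rintro h _ ⟨X, hX, rfl⟩ _ ⟨Y, hY, rfl⟩
    refine ⟨-(⁅R X, Y⁆ - ⁅R Y, X⁆), G₁.neg_mem (hW hX hY), ?_⟩
    have hYB : R ⁅R X, Y⁆ - R ⁅R Y, X⁆ = ⁅X, Y⁆ + ⁅R X, R Y⁆ := by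
      rw [← sub_eq_zero, ← h X hX Y hY]
      abel
    simp only [LinearMap.sub_apply, LinearMap.id_apply, key]
    rw [map_neg, map_sub, hYB]
    abel
end

section
/- In the ℤ₂-graded setting with a complementary subalgebra G₋, if additionally ⁅G₁, G₁⁆ = {0}, then G₁ with the product X∘Y = ⁅π₊(X), Y⁆ is a left-symmetric algebra: for all X, Y, Z ∈ G₁, (X∘Y)∘Z − X∘(Y∘Z) = (Y∘X)∘Z − Y∘(X∘Z), i.e. [X,Y,Z] = 0. -/
/-- If `π` is the projection onto `G₀` along `Gm`, then `x - π x` lies in `Gm`. -/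
theorem sub_proj_mem_of_isCompl {R M : Type*} [Ring R] [AddCommGroup M] [Module R M]
    {G₀ Gm : Submodule R M} (hcompl : IsCompl G₀ Gm) (π : M →ₗ[R] M)
    (hπid : ∀ x ∈ G₀, π x = x) (hπm : ∀ x ∈ Gm, π x = 0) (x : M) : x - π x ∈ Gm := by
  obtain ⟨a, ha, m, hm, rfl⟩ :=
    Submodule.mem_sup.mp (hcompl.sup_eq_top ▸ Submodule.mem_top : x ∈ G₀ ⊔ Gm)
  simpa [hπid a ha, hπm m hm] using hm

/-- In the ℤ₂-graded setting `G = G₀ ⊕ G₁` with a complementary subalgebra `G₋`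
(`G = G₀ ⊕ G₋`, projection `π₊` onto `G₀` along `G₋`), if moreover `⁅G₁, G₁⁆ = {0}`, then
`G₁` with the product `X∘Y = ⁅π₊ X, Y⁆` is left-symmetric:
`(X∘Y)∘Z − X∘(Y∘Z) = (Y∘X)∘Z − Y∘(X∘Z)`. -/
theorem stmt_8 {G : Type*} [LieRing G] [LieAlgebra ℂ G]
    (G₀ G₁ Gm : Submodule ℂ G)
    (hcompl01 : IsCompl G₀ G₁)
    (h00 : ∀ x ∈ G₀, ∀ y ∈ G₀, ⁅x, y⁆ ∈ G₀)
    (h01 : ∀ x ∈ G₀, ∀ y ∈ G₁, ⁅x, y⁆ ∈ G₁)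
    (h11 : ∀ x ∈ G₁, ∀ y ∈ G₁, ⁅x, y⁆ = (0 : G))
    (hGm : ∀ x ∈ Gm, ∀ y ∈ Gm, ⁅x, y⁆ ∈ Gm)
    (hcompl0m : IsCompl G₀ Gm)
    (π : G →ₗ[ℂ] G)
    (hπ0 : ∀ x : G, π x ∈ G₀)
    (hπid : ∀ x ∈ G₀, π x = x)
    (hπm : ∀ x ∈ Gm, π x = 0) :
    ∀ X ∈ G₁, ∀ Y ∈ G₁, ∀ Z ∈ G₁,
      ⁅π ⁅π X, Y⁆, Z⁆ - ⁅π X, ⁅π Y, Z⁆⁆ = ⁅π ⁅π Y, X⁆, Z⁆ - ⁅π Y, ⁅π X, Z⁆⁆ := by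
  intro X hX Y hY Z _
  have hmem := sub_proj_mem_of_isCompl hcompl0m π hπid hπm
  have hker : π ⁅X - π X, Y - π Y⁆ = 0 := hπm _ (hGm _ (hmem X) _ (hmem Y))
  have hbracket : π ⁅π X, Y⁆ - π ⁅π Y, X⁆ = ⁅π X, π Y⁆ := by
    rw [sub_lie, lie_sub, lie_sub, h11 X hX Y hY, ← lie_skew X (π Y), map_sub, map_sub, map_sub,
      map_zero, map_neg, hπid _ (h00 _ (hπ0 X) _ (hπ0 Y))] at hker
    rw [← sub_eq_zero, ← neg_eq_zero, ← hker]
    abel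
  have hjacobi : ⁅π ⁅π X, Y⁆, Z⁆ - ⁅π ⁅π Y, X⁆, Z⁆ = ⁅π X, ⁅π Y, Z⁆⁆ - ⁅π Y, ⁅π X, Z⁆⁆ := by
    rw [← sub_lie, hbracket, lie_lie]
  rw [sub_eq_sub_iff_sub_eq_sub, hjacobi]
end

section
/- In the ℤ₂-graded setting with a complementary subalgebra G₋, for all X, Y, Z ∈ G₁ the following identity holds for the product X∘Y = ⁅π₊(X), Y⁆: the skew-symmetrized associator equals the double Lie bracket, [X,Y,Z] = ⁅⁅X,Y⁆, Z⁆, where ⁅·,·⁆ is the Lie bracket of G (note ⁅X,Y⁆ ∈ G₀ and ⁅⁅X,Y⁆,Z⁆ ∈ G₁ by the grading). -/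
/-- A linear map that is the identity on `p` and vanishes on a complement `q` of `p` differs from
the identity by elements of `q`. -/
theorem sub_map_mem_of_isCompl {R M : Type*} [Ring R] [AddCommGroup M] [Module R M]
    {p q : Submodule R M} (h : IsCompl p q) {f : M →ₗ[R] M}
    (hp : ∀ x ∈ p, f x = x) (hq : ∀ x ∈ q, f x = 0) (x : M) : x - f x ∈ q := by
  obtain ⟨a, ha, b, hb, rfl⟩ := Submodule.mem_sup.1 (h.sup_eq_top ▸ Submodule.mem_top : x ∈ p ⊔ q)
  simpa [hp a ha, hq b hb] using hb


/-- In the ℤ₂-graded setting `G = G₀ ⊕ G₁` with a complementary subalgebra `G₋`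
(`G = G₀ ⊕ G₋`, projection `π₊` onto `G₀` along `G₋`), for the product `X∘Y = ⁅π₊ X, Y⁆` on
`G₁` the skew-symmetrized associator equals the double Lie bracket:
`[X,Y,Z] = ⁅⁅X,Y⁆, Z⁆`. -/
theorem stmt_9 {G : Type*} [LieRing G] [LieAlgebra ℂ G]
    (G₀ G₁ Gm : Submodule ℂ G)
    (hcompl01 : IsCompl G₀ G₁)
    (h00 : ∀ x ∈ G₀, ∀ y ∈ G₀, ⁅x, y⁆ ∈ G₀)
    (h01 : ∀ x ∈ G₀, ∀ y ∈ G₁, ⁅x, y⁆ ∈ G₁)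
    (h11 : ∀ x ∈ G₁, ∀ y ∈ G₁, ⁅x, y⁆ ∈ G₀)
    (hGm : ∀ x ∈ Gm, ∀ y ∈ Gm, ⁅x, y⁆ ∈ Gm)
    (hcompl0m : IsCompl G₀ Gm)
    (π : G →ₗ[ℂ] G)
    (hπ0 : ∀ x : G, π x ∈ G₀)
    (hπid : ∀ x ∈ G₀, π x = x)
    (hπm : ∀ x ∈ Gm, π x = 0) :
    ∀ X ∈ G₁, ∀ Y ∈ G₁, ∀ Z ∈ G₁,
      (⁅π ⁅π X, Y⁆, Z⁆ - ⁅π X, ⁅π Y, Z⁆⁆) - (⁅π ⁅π Y, X⁆, Z⁆ - ⁅π Y, ⁅π X, Z⁆⁆)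
        = ⁅(⁅X, Y⁆ : G), Z⁆ := by
  intro X hX Y hY Z _
  have hmem := sub_map_mem_of_isCompl hcompl0m hπid hπm
  have hproj := hπm _ (hGm _ (hmem X) _ (hmem Y))
  simp only [sub_lie, lie_sub, map_sub, hπid _ (h11 X hX Y hY),
    hπid _ (h00 _ (hπ0 X) _ (hπ0 Y))] at hproj
  have hskew : π ⁅π Y, X⁆ = -π ⁅X, π Y⁆ := by rw [← lie_skew, map_neg]
  have hbracket : ⁅X, Y⁆ = π ⁅π X, Y⁆ - π ⁅π Y, X⁆ - ⁅π X, π Y⁆ := by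
    rw [hskew, ← sub_eq_zero, ← hproj]
    abel
  rw [hbracket, sub_lie, sub_lie, lie_lie (π X) (π Y) Z]
  abel
end

section
/- In the ℤ₂-graded setting with a complementary subalgebra G₋, the vector space G₁ equipped with the product X∘Y = ⁅π₊(X), Y⁆ is a G-algebra, i.e. it satisfies both identities: (t1) [X,Y,Z] + [Y,Z,X] + [Z,X,Y] = 0 and (t2) V∘[X,Y,Z] = [V∘X, Y, Z] + [X, V∘Y, Z] + [X, Y, V∘Z] for all V, X, Y, Z ∈ G₁. -/
/-- The product `X∘Y := ⁅π X, Y⁆` on `G` determined by a linear map `π`. -/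
def gmul {G : Type*} [LieRing G] [LieAlgebra ℂ G] (π : G →ₗ[ℂ] G) (X Y : G) : G :=
  ⁅π X, Y⁆

/-- The skew-symmetrized associator `[X,Y,Z] = As(X,Y,Z) − As(Y,X,Z)` of the product `gmul π`,
where `As(X,Y,Z) = (X∘Y)∘Z − X∘(Y∘Z)`. -/
def gtriple {G : Type*} [LieRing G] [LieAlgebra ℂ G] (π : G →ₗ[ℂ] G) (X Y Z : G) : G :=
  (gmul π (gmul π X Y) Z - gmul π X (gmul π Y Z))
    - (gmul π (gmul π Y X) Z - gmul π Y (gmul π X Z))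

/-- The skew-symmetrized associator on the odd part is the Lie triple product. -/
theorem gtriple_eq_lie_lie {G : Type*} [LieRing G] [LieAlgebra ℂ G] {π : G →ₗ[ℂ] G} {X Y : G}
    (hπ : π ⁅X - π X, Y - π Y⁆ = 0) (hXY : π ⁅X, Y⁆ = ⁅X, Y⁆)
    (hπXY : π ⁅π X, π Y⁆ = ⁅π X, π Y⁆) (Z : G) :
    gtriple π X Y Z = ⁅⁅X, Y⁆, Z⁆ := by
  have h : ⁅X, Y⁆ = π ⁅π X, Y⁆ - π ⁅π Y, X⁆ - ⁅π X, π Y⁆ := by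
    rw [← lie_skew (π Y) X, map_neg]
    simp only [lie_sub, sub_lie, map_sub, hXY, hπXY] at hπ
    rw [← sub_eq_zero, ← hπ]
    abel
  rw [h]
  simp only [gtriple, gmul, sub_lie, lie_lie (π X) (π Y) Z]
  abel

/-- The complement component of an element for a projection with kernel containing `Gm`. -/
theorem sub_map_mem_of_isCompl_s10 {G : Type*} [AddCommGroup G] [Module ℂ G] {G₀ Gm : Submodule ℂ G}
    (h : IsCompl G₀ Gm) {π : G →ₗ[ℂ] G} (hπid : ∀ x ∈ G₀, π x = x) (hπm : ∀ x ∈ Gm, π x = 0)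
    (x : G) : x - π x ∈ Gm := by
  have hx : x ∈ G₀ ⊔ Gm := h.sup_eq_top ▸ Submodule.mem_top
  obtain ⟨a, ha, b, hb, rfl⟩ := Submodule.mem_sup.1 hx
  simpa [hπid a ha, hπm b hb] using hb

/-- In the ℤ₂-graded setting `G = G₀ ⊕ G₁` with a complementary subalgebra `G₋`
(`G = G₀ ⊕ G₋`, projection `π₊` onto `G₀` along `G₋`), the space `G₁` with the product
`X∘Y = ⁅π₊ X, Y⁆` is a G-algebra: it satisfies
(t1) `[X,Y,Z] + [Y,Z,X] + [Z,X,Y] = 0` and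
(t2) `V∘[X,Y,Z] = [V∘X,Y,Z] + [X,V∘Y,Z] + [X,Y,V∘Z]`. -/
theorem stmt_10 {G : Type*} [LieRing G] [LieAlgebra ℂ G]
    (G₀ G₁ Gm : Submodule ℂ G)
    (hcompl01 : IsCompl G₀ G₁)
    (h00 : ∀ x ∈ G₀, ∀ y ∈ G₀, ⁅x, y⁆ ∈ G₀)
    (h01 : ∀ x ∈ G₀, ∀ y ∈ G₁, ⁅x, y⁆ ∈ G₁)
    (h11 : ∀ x ∈ G₁, ∀ y ∈ G₁, ⁅x, y⁆ ∈ G₀)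
    (hGm : ∀ x ∈ Gm, ∀ y ∈ Gm, ⁅x, y⁆ ∈ Gm)
    (hcompl0m : IsCompl G₀ Gm)
    (π : G →ₗ[ℂ] G)
    (hπ0 : ∀ x : G, π x ∈ G₀)
    (hπid : ∀ x ∈ G₀, π x = x)
    (hπm : ∀ x ∈ Gm, π x = 0) :
    ∀ V ∈ G₁, ∀ X ∈ G₁, ∀ Y ∈ G₁, ∀ Z ∈ G₁,
      (gtriple π X Y Z + gtriple π Y Z X + gtriple π Z X Y = 0) ∧
      (gmul π V (gtriple π X Y Z)
        = gtriple π (gmul π V X) Y Z + gtriple π X (gmul π V Y) Z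
            + gtriple π X Y (gmul π V Z)) := by
  have key : ∀ X ∈ G₁, ∀ Y ∈ G₁, ∀ Z, gtriple π X Y Z = ⁅⁅X, Y⁆, Z⁆ := fun X hX Y hY Z =>
    gtriple_eq_lie_lie
      (hπm _ (hGm _ (sub_map_mem_of_isCompl_s10 hcompl0m hπid hπm X)
        _ (sub_map_mem_of_isCompl_s10 hcompl0m hπid hπm Y)))
      (hπid _ (h11 X hX Y hY)) (hπid _ (h00 _ (hπ0 X) _ (hπ0 Y))) Z
  intro V _ X hX Y hY Z hZ
  have hVX : gmul π V X ∈ G₁ := h01 _ (hπ0 V) X hX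
  have hVY : gmul π V Y ∈ G₁ := h01 _ (hπ0 V) Y hY
  rw [key X hX Y hY, key Y hY Z hZ, key Z hZ X hX, key _ hVX Y hY, key X hX _ hVY,
    key X hX Y hY]
  refine ⟨?_, ?_⟩
  · rw [← lie_skew ⁅X, Y⁆ Z, ← lie_skew ⁅Y, Z⁆ X, ← lie_skew ⁅Z, X⁆ Y, ← neg_eq_zero,
      ← lie_jacobi X Y Z]
    abel
  · simp only [gmul]
    rw [leibniz_lie (π V) ⁅X, Y⁆ Z, leibniz_lie (π V) X Y, add_lie]
end

section
/- Let G be a finite-dimensional semisimple Lie algebra over ℂ, R : G → G a linear operator, and define the bilinear skew-symmetric bracket [X,Y]₁ = ⁅R(X), Y⁆ + ⁅X, R(Y)⁆ − R(⁅X,Y⁆). Then [·,·]₁ satisfies the Jacobi identity (is a Lie bracket) if and only if there exists a linear operator S : G → G such that R(⁅R(X),Y⁆ − ⁅R(Y),X⁆) − ⁅R(X), R(Y)⁆ − R²(⁅X,Y⁆) = ⁅S(X), Y⁆ − ⁅S(Y), X⁆ − S(⁅X,Y⁆) for all X, Y ∈ G. -/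
/-- The deformed bracket `[X,Y]₁ = ⁅R X, Y⁆ + ⁅X, R Y⁆ − R ⁅X,Y⁆` associated to a linear
operator `R` on a Lie algebra. -/
def defBracket {G : Type*} [LieRing G] [LieAlgebra ℂ G] (R : G →ₗ[ℂ] G) (X Y : G) : G :=
  ⁅R X, Y⁆ + ⁅X, R Y⁆ - R ⁅X, Y⁆

/-- The Jacobi identity with all brackets nested on the left. -/
lemma lie_lie_jacobi {L : Type*} [LieRing L] (x y z : L) :
    ⁅⁅x, y⁆, z⁆ + ⁅⁅y, z⁆, x⁆ + ⁅⁅z, x⁆, y⁆ = 0 := by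
  rw [lie_lie, ← lie_skew _ x, ← lie_skew _ y, ← lie_skew z x, lie_neg]
  abel

/-- A coboundary is a cocycle. -/
lemma cocycle_of_coboundary {K G : Type*} [Field K] [LieRing G] [LieAlgebra K G]
    {ω : G →ₗ[K] G →ₗ[K] G} {S : G →ₗ[K] G}
    (hS : ∀ x y, ω x y = ⁅S x, y⁆ - ⁅S y, x⁆ - S ⁅x, y⁆) (x y z : G) :
    ⁅x, ω y z⁆ + ⁅y, ω z x⁆ + ⁅z, ω x y⁆ - ω ⁅x, y⁆ z - ω ⁅y, z⁆ x - ω ⁅z, x⁆ y = 0 := by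
  have jacS : S ⁅⁅x, y⁆, z⁆ + S ⁅⁅y, z⁆, x⁆ + S ⁅⁅z, x⁆, y⁆ = 0 := by
    rw [← map_add, ← map_add, lie_lie_jacobi, map_zero]
  simp only [hS, lie_sub]
  rw [← lie_skew x (S ⁅y, z⁆), ← lie_skew y (S ⁅z, x⁆), ← lie_skew z (S ⁅x, y⁆),
    leibniz_lie (S z) x y, leibniz_lie (S x) y z, leibniz_lie (S y) z x]
  rw [← lie_skew ⁅S z, x⁆ y, ← lie_skew ⁅S x, y⁆ z, ← lie_skew ⁅S y, z⁆ x]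
  linear_combination (norm := module) jacS

section CasimirHomotopy

open LieAlgebra LieModule Module

variable {K G ι : Type*} [Field K] [LieRing G] [LieAlgebra K G]
  [LieAlgebra.IsKilling K G] [Fintype ι] [DecidableEq ι] (e : Basis ι K G)

/-- The basis dual to `e` with respect to the Killing form. -/
noncomputable def killingDualBasis : Basis ι K G :=
  LinearMap.BilinForm.dualBasis (killingForm K G) (IsKilling.killingForm_nondegenerate K G) e

lemma killingDualBasis_repr_apply (x : G) (i : ι) :
    (killingDualBasis e).repr x i = killingForm K G x (e i) :=
  LinearMap.BilinForm.dualBasis_repr_apply _ _ _ _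

lemma repr_eq_killingForm_killingDualBasis (y : G) (i : ι) :
    e.repr y i = killingForm K G (killingDualBasis e i) y := by
  have h (j : ι) : killingForm K G (killingDualBasis e i) (e j) = if j = i then 1 else 0 :=
    LinearMap.BilinForm.apply_dualBasis_left _ _ _ _
  conv_rhs => rw [← e.sum_repr y]
  simp only [map_sum, map_smul, h]
  simp

/-- The canonical tensor `∑ i, e i ⊗ f i` of dual bases for the Killing form is invariant. -/
lemma sum_lie_killingDualBasis_eq_zero {M : Type*} [AddCommGroup M] [Module K M]
    (T : G →ₗ[K] G →ₗ[K] M) (x : G) :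
    ∑ i, (T ⁅x, e i⁆ (killingDualBasis e i) + T (e i) ⁅x, killingDualBasis e i⁆) = 0 := by
  have hl (i : ι) : T ⁅x, e i⁆ (killingDualBasis e i) = ∑ j,
      killingForm K G (killingDualBasis e j) ⁅x, e i⁆ • T (e j) (killingDualBasis e i) := by
    conv_lhs => rw [← e.sum_repr ⁅x, e i⁆]
    simp only [repr_eq_killingForm_killingDualBasis, map_sum, map_smul, LinearMap.sum_apply,
      LinearMap.smul_apply]
  have hr (j : ι) : T (e j) ⁅x, killingDualBasis e j⁆ = ∑ i,
      -(killingForm K G (killingDualBasis e j) ⁅x, e i⁆ • T (e j) (killingDualBasis e i)) := by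
    conv_lhs => rw [← (killingDualBasis e).sum_repr ⁅x, killingDualBasis e j⁆]
    simp only [killingDualBasis_repr_apply, map_sum, map_smul, traceForm_apply_lie_apply',
      neg_smul, map_neg]
  simp_rw [Finset.sum_add_distrib, hl, hr]
  rw [Finset.sum_comm]
  simp

/-- The Casimir element of the Killing form acts as the identity in the adjoint representation. -/
lemma sum_lie_lie_killingDualBasis (x : G) :
    ∑ i, ⁅e i, ⁅killingDualBasis e i, x⁆⁆ = x := by
  refine LinearMap.ker_eq_bot.mp (IsKilling.ker_killingForm_eq_bot K G) (LinearMap.ext fun y ↦ ?_)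
  rw [killingForm_apply_apply K G x y, LinearMap.trace_eq_matrix_trace K e, Matrix.trace]
  simp only [map_sum, LinearMap.sum_apply, Matrix.diag_apply, LinearMap.toMatrix_apply,
    repr_eq_killingForm_killingDualBasis, LinearMap.comp_apply, ad_apply]
  refine Finset.sum_congr rfl fun i _ ↦ ?_
  rw [traceForm_apply_lie_apply', traceForm_apply_lie_apply, ← lie_skew y (e i), lie_neg, map_neg]

/-- Second Whitehead lemma for the adjoint representation: every 2-cocycle is a coboundary. -/
lemma exists_coboundary_of_cocycle [FiniteDimensional K G] (ω : G →ₗ[K] G →ₗ[K] G)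
    (hskew : ∀ x y, ω x y = -ω y x)
    (hω : ∀ x y z, ⁅x, ω y z⁆ + ⁅y, ω z x⁆ + ⁅z, ω x y⁆
      - ω ⁅x, y⁆ z - ω ⁅y, z⁆ x - ω ⁅z, x⁆ y = 0) :
    ∃ S : G →ₗ[K] G, ∀ x y, ω x y = ⁅S x, y⁆ - ⁅S y, x⁆ - S ⁅x, y⁆ := by
  let e := finBasis K G
  let f := killingDualBasis e
  let S : G →ₗ[K] G := ∑ i, (ad K G (e i)) ∘ₗ ω (f i)
  have hS (x : G) : S x = ∑ i, ⁅e i, ω (f i) x⁆ := by simp [S]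
  have hinv (x y : G) : ∑ i, (⁅⁅x, e i⁆, ω (f i) y⁆ + ⁅e i, ω ⁅x, f i⁆ y⁆) = 0 :=
    sum_lie_killingDualBasis_eq_zero e ((ad K G : G →ₗ[K] End K G).compl₂ (ω.flip y)) x
  refine ⟨S, fun x y ↦ ?_⟩
  have hcas : ω x y = ∑ i, ⁅e i, ⁅f i, ω x y⁆⁆ := (sum_lie_lie_killingDualBasis e _).symm
  have hsum : ⁅S x, y⁆ - ⁅S y, x⁆ - S ⁅x, y⁆ - ω x y
      = ∑ i, (⁅⁅x, e i⁆, ω (f i) y⁆ + ⁅e i, ω ⁅x, f i⁆ y⁆)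
        - ∑ i, (⁅⁅y, e i⁆, ω (f i) x⁆ + ⁅e i, ω ⁅y, f i⁆ x⁆) := by
    rw [hcas, hS, hS, hS, sum_lie, sum_lie]
    simp only [← Finset.sum_sub_distrib]
    refine Finset.sum_congr rfl fun i _ ↦ ?_
    have h := congrArg (fun z ↦ ⁅e i, z⁆) (hω (f i) x y)
    simp only [lie_add, lie_sub, lie_zero] at h
    rw [hskew y (f i), hskew ⁅x, y⁆ (f i), ← lie_skew (f i) x, map_neg, LinearMap.neg_apply] at h
    rw [lie_lie x, lie_lie y, ← lie_skew (⁅e i, ω (f i) x⁆) y, ← lie_skew (⁅e i, ω (f i) y⁆) x]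
    simp only [lie_neg] at h
    linear_combination (norm := module) -h
  rw [hinv, hinv, sub_zero, sub_eq_zero] at hsum
  exact hsum.symm

end CasimirHomotopy

section DeformedBracket

variable {G : Type*} [LieRing G] [LieAlgebra ℂ G] (R : G →ₗ[ℂ] G)

/-- The (negative) Nijenhuis torsion of `R`, as a bilinear map. -/
def torsion : G →ₗ[ℂ] G →ₗ[ℂ] G :=
  LinearMap.mk₂ ℂ (fun X Y ↦ R (⁅R X, Y⁆ - ⁅R Y, X⁆) - ⁅R X, R Y⁆ - R (R ⁅X, Y⁆))
    (fun _ _ _ ↦ by simp only [map_add, map_sub, add_lie, lie_add]; abel)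
    (fun _ _ _ ↦ by simp only [map_smul, map_sub, smul_lie, lie_smul, smul_sub])
    (fun _ _ _ ↦ by simp only [map_add, map_sub, add_lie, lie_add]; abel)
    (fun _ _ _ ↦ by simp only [map_smul, map_sub, smul_lie, lie_smul, smul_sub])

lemma torsion_apply (X Y : G) :
    torsion R X Y = R (⁅R X, Y⁆ - ⁅R Y, X⁆) - ⁅R X, R Y⁆ - R (R ⁅X, Y⁆) := rfl

lemma torsion_skew (X Y : G) : torsion R X Y = -torsion R Y X := by
  rw [torsion_apply, torsion_apply, ← lie_skew X Y, ← lie_skew (R X) (R Y)]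
  simp only [map_sub, map_neg]
  abel

/-- The Jacobiator of the deformed bracket is minus the coboundary of the torsion. -/
lemma jacobiator_defBracket (X Y Z : G) :
    defBracket R (defBracket R X Y) Z + defBracket R (defBracket R Y Z) X
        + defBracket R (defBracket R Z X) Y
      = -(⁅X, torsion R Y Z⁆ + ⁅Y, torsion R Z X⁆ + ⁅Z, torsion R X Y⁆
        - torsion R ⁅X, Y⁆ Z - torsion R ⁅Y, Z⁆ X - torsion R ⁅Z, X⁆ Y) := by
  have jac (A B C : G) : ⁅⁅A, B⁆, C⁆ + ⁅⁅B, C⁆, A⁆ - ⁅⁅A, C⁆, B⁆ = 0 := by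
    rw [← lie_lie_jacobi A B C, ← lie_skew C A, neg_lie, sub_eq_add_neg]
  have jacR (A B C : G) : R ⁅⁅A, B⁆, C⁆ + R ⁅⁅B, C⁆, A⁆ - R ⁅⁅A, C⁆, B⁆ = 0 := by
    rw [← map_add, ← map_sub, jac, map_zero]
  have jacRR : R (R ⁅⁅X, Y⁆, Z⁆) + R (R ⁅⁅Y, Z⁆, X⁆) + R (R ⁅⁅Z, X⁆, Y⁆) = 0 := by
    simp only [← map_add, lie_lie_jacobi, map_zero]
  rw [← lie_skew X (torsion R Y Z), ← lie_skew Y (torsion R Z X), ← lie_skew Z (torsion R X Y)]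
  simp only [torsion_apply, defBracket, add_lie, sub_lie, map_add, map_sub,
    ← lie_skew X (R Y), ← lie_skew Y (R Z), ← lie_skew Z (R X), neg_lie, map_neg,
    ← lie_skew (R _) ⁅_, _⁆]
  linear_combination (norm := module) jac (R X) (R Y) Z + jac (R Y) (R Z) X + jac (R Z) (R X) Y
    - jacR (R X) Y Z - jacR (R Y) Z X - jacR (R Z) X Y + jacRR

end DeformedBracket

/-- For a finite-dimensional semisimple Lie algebra `G` over ℂ and a linear operator `R`,
the deformed bracket `[X,Y]₁ = ⁅R X,Y⁆ + ⁅X,R Y⁆ − R⁅X,Y⁆` satisfies the Jacobi identity iff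
there is a linear operator `S` with
`R(⁅R X,Y⁆ − ⁅R Y,X⁆) − ⁅R X, R Y⁆ − R²⁅X,Y⁆ = ⁅S X, Y⁆ − ⁅S Y, X⁆ − S⁅X,Y⁆`. -/
theorem stmt_12 {G : Type*} [LieRing G] [LieAlgebra ℂ G]
    [FiniteDimensional ℂ G] [LieAlgebra.IsSemisimple ℂ G]
    (R : G →ₗ[ℂ] G) :
    (∀ X Y Z : G,
      defBracket R (defBracket R X Y) Z + defBracket R (defBracket R Y Z) X
        + defBracket R (defBracket R Z X) Y = 0)
    ↔ ∃ S : G →ₗ[ℂ] G, ∀ X Y : G,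
        R (⁅R X, Y⁆ - ⁅R Y, X⁆) - ⁅R X, R Y⁆ - R (R ⁅X, Y⁆)
          = ⁅S X, Y⁆ - ⁅S Y, X⁆ - S ⁅X, Y⁆ := by
  simp only [jacobiator_defBracket, neg_eq_zero, ← torsion_apply]
  exact ⟨exists_coboundary_of_cocycle (torsion R) (torsion_skew R),
    fun ⟨S, hS⟩ ↦ cocycle_of_coboundary hS⟩
end

section
/- Let G be a Lie algebra over ℂ and R : G → G a linear operator satisfying R(⁅R(X),Y⁆ − ⁅R(Y),X⁆) − ⁅R(X), R(Y)⁆ − R²(⁅X,Y⁆) = 0 for all X, Y ∈ G. Then the bracket [X,Y]₁ = ⁅R(X),Y⁆ + ⁅X,R(Y)⁆ − R(⁅X,Y⁆) is a Lie bracket on G that is compatible with ⁅·,·⁆: for every λ ∈ ℂ the bracket ⁅X,Y⁆ + λ[X,Y]₁ satisfies the Jacobi identity. -/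
/-- The Jacobi identity in left-normed cyclic form. -/
theorem lie_lie_cyclic {L : Type*} [LieRing L] (a b c : L) :
    ⁅⁅a, b⁆, c⁆ + ⁅⁅b, c⁆, a⁆ + ⁅⁅c, a⁆, b⁆ = 0 := by
  rw [← lie_skew ⁅a, b⁆ c, ← lie_skew ⁅b, c⁆ a, ← lie_skew ⁅c, a⁆ b]
  linear_combination (norm := module) -lie_jacobi a b c

section defBracket

variable {G : Type*} [LieRing G] [LieAlgebra ℂ G] (R : G →ₗ[ℂ] G)

theorem defBracket_add_smul (lam : ℂ) (A B Z : G) :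
    defBracket R (A + lam • B) Z = defBracket R A Z + lam • defBracket R B Z := by
  simp only [defBracket, map_add, map_smul, add_lie, smul_lie]
  module

/-- The mixed Jacobi identity of a bracket and its deformation, valid for every linear map. -/
theorem defBracket_mixed_jacobi (X Y Z : G) :
    ⁅defBracket R X Y, Z⁆ + defBracket R ⁅X, Y⁆ Z
      + (⁅defBracket R Y Z, X⁆ + defBracket R ⁅Y, Z⁆ X)
      + (⁅defBracket R Z X, Y⁆ + defBracket R ⁅Z, X⁆ Y) = 0 := by
  have h := congrArg R (lie_lie_cyclic X Y Z)
  simp only [map_add, map_zero] at h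
  simp only [defBracket, add_lie, sub_lie]
  linear_combination (norm := module) lie_lie_cyclic (R X) Y Z + lie_lie_cyclic X (R Y) Z
    + lie_lie_cyclic X Y (R Z) - h

/-- The deformed bracket of a Nijenhuis operator satisfies the Jacobi identity. -/
theorem defBracket_jacobi (hR : ∀ X Y : G, R (defBracket R X Y) = ⁅R X, R Y⁆) (X Y Z : G) :
    defBracket R (defBracket R X Y) Z + defBracket R (defBracket R Y Z) X
      + defBracket R (defBracket R Z X) Y = 0 := by
  have key (A B C : G) : defBracket R (defBracket R A B) C =
      ⁅⁅R A, R B⁆, C⁆ + ⁅⁅R A, B⁆, R C⁆ + ⁅⁅A, R B⁆, R C⁆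
        - R (⁅⁅R A, B⁆, C⁆ + ⁅⁅A, R B⁆, C⁆ + ⁅⁅A, B⁆, R C⁆) + R (R ⁅⁅A, B⁆, C⁆) := by
    have h := hR ⁅A, B⁆ C
    rw [defBracket, hR]
    simp only [defBracket, add_lie, sub_lie, map_add, map_sub] at h ⊢
    linear_combination (norm := module) h
  have h (A B C : G) := congrArg R (lie_lie_cyclic A B C)
  have h₂ := congrArg R (h X Y Z)
  simp only [map_add, map_zero] at h h₂
  simp only [key, map_add]
  linear_combination (norm := module) lie_lie_cyclic (R X) (R Y) Z
    + lie_lie_cyclic (R X) Y (R Z) + lie_lie_cyclic X (R Y) (R Z)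
    - h (R X) Y Z - h X (R Y) Z - h X Y (R Z) + h₂

end defBracket

/-- If `R` satisfies `R(⁅R X,Y⁆ − ⁅R Y,X⁆) − ⁅R X, R Y⁆ − R²⁅X,Y⁆ = 0`, then the deformed
bracket `[X,Y]₁` is a Lie bracket compatible with `⁅·,·⁆`: every pencil
`⁅X,Y⁆ + λ[X,Y]₁` satisfies the Jacobi identity. -/
theorem stmt_13 {G : Type*} [LieRing G] [LieAlgebra ℂ G] (R : G →ₗ[ℂ] G)
    (hR : ∀ X Y : G,
      R (⁅R X, Y⁆ - ⁅R Y, X⁆) - ⁅R X, R Y⁆ - R (R ⁅X, Y⁆) = 0) :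
    (∀ X Y Z : G,
      defBracket R (defBracket R X Y) Z + defBracket R (defBracket R Y Z) X
        + defBracket R (defBracket R Z X) Y = 0)
    ∧ ∀ (lam : ℂ) (X Y Z : G),
      (⁅(⁅X, Y⁆ + lam • defBracket R X Y), Z⁆
          + lam • defBracket R (⁅X, Y⁆ + lam • defBracket R X Y) Z)
      + (⁅(⁅Y, Z⁆ + lam • defBracket R Y Z), X⁆
          + lam • defBracket R (⁅Y, Z⁆ + lam • defBracket R Y Z) X)
      + (⁅(⁅Z, X⁆ + lam • defBracket R Z X), Y⁆
          + lam • defBracket R (⁅Z, X⁆ + lam • defBracket R Z X) Y) = 0 := by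
  have hN (X Y : G) : R (defBracket R X Y) = ⁅R X, R Y⁆ := by
    have h := hR X Y
    rw [← lie_skew (R Y) X] at h
    simp only [defBracket, map_add, map_sub, map_neg] at h ⊢
    linear_combination (norm := module) h
  refine ⟨defBracket_jacobi R hN, fun lam X Y Z => ?_⟩
  simp only [defBracket_add_smul, add_lie, smul_lie]
  linear_combination (norm := module) lie_lie_cyclic X Y Z
    + lam • defBracket_mixed_jacobi R X Y Z + lam ^ 2 • defBracket_jacobi R hN X Y Z
end

section
/- Let G be a Lie algebra over ℂ, [·,·]₁ a bilinear operation on G, Λ ⊆ ℂ, and A : Λ → GL(G) a family of invertible linear operators such that ⁅A_λ(X), A_λ(Y)⁆ = A_λ(⁅X,Y⁆ + λ[X,Y]₁) for all λ ∈ Λ and X, Y ∈ G. Define r(u,v) := (u−v)⁻¹ · (A_u ∘ A_v⁻¹) ∈ End(G) for u ≠ v in Λ. Then r satisfies the operator form of the classical Yang–Baxter equation: for all pairwise distinct u, v, w ∈ Λ and all x, y ∈ G, ⁅r(u,w)(x), r(u,v)(y)⁆ = r(u,v)(⁅r(v,w)(x), y⁆) + r(u,w)(⁅x, r(w,v)(y)⁆).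 -/
/-- The operator `r(u,v) = (u−v)⁻¹ · A_u ∘ A_v⁻¹` built from a family of invertible linear
operators. -/
noncomputable def rOp {G : Type*} [AddCommGroup G] [Module ℂ G]
    (A : ℂ → (G ≃ₗ[ℂ] G)) (u v : ℂ) (x : G) : G :=
  (u - v)⁻¹ • (A u ((A v).symm x))

/-- If the family `A_λ` intertwines the Lie bracket of `G` with the pencil
`⁅X,Y⁆ + λ[X,Y]₁`, then `r(u,v) = (u−v)⁻¹ A_u A_v⁻¹` satisfies the operator form of the
classical Yang–Baxter equation. -/
theorem stmt_14 {G : Type*} [LieRing G] [LieAlgebra ℂ G]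
    (br1 : G →ₗ[ℂ] G →ₗ[ℂ] G) (Λ : Set ℂ) (A : ℂ → (G ≃ₗ[ℂ] G))
    (hA : ∀ lam ∈ Λ, ∀ X Y : G,
      ⁅A lam X, A lam Y⁆ = A lam (⁅X, Y⁆ + lam • br1 X Y)) :
    ∀ u ∈ Λ, ∀ v ∈ Λ, ∀ w ∈ Λ, u ≠ v → u ≠ w → v ≠ w → ∀ x y : G,
      ⁅rOp A u w x, rOp A u v y⁆
        = rOp A u v ⁅rOp A v w x, y⁆ + rOp A u w ⁅x, rOp A w v y⁆ := by
  intro u hu v hv w hw huv huw hvw x y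
  obtain ⟨X, rfl⟩ := (A w).surjective x
  obtain ⟨Y, rfl⟩ := (A v).surjective y
  have huv' := sub_ne_zero.mpr huv
  have huw' := sub_ne_zero.mpr huw
  have hvw' := sub_ne_zero.mpr hvw
  have hwv' := sub_ne_zero.mpr hvw.symm
  simp only [rOp, LinearEquiv.symm_apply_apply, smul_lie, lie_smul, hA u hu, hA v hv, hA w hw,
    map_smul, map_add]
  match_scalars
  · field_simp
    ring
  · field_simp
    ring
end

section
/- For any matrices a, b ∈ Mat₂(ℂ), the bilinear product X∘Y = (aX − Xa)(bY − Yb) on Mat₂(ℂ) is compatible with the standard matrix product: for every λ ∈ ℂ the multiplication X ∙ Y = XY + λ(X∘Y) is associative (in particular, ∘ itself is an associative product). -/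
/-- The product `X∘Y = (aX − Xa)(bY − Yb)` on 2×2 matrices. -/
noncomputable def circProd (a b X Y : Matrix (Fin 2) (Fin 2) ℂ) : Matrix (Fin 2) (Fin 2) ℂ :=
  (a * X - X * a) * (b * Y - Y * b)

/-- The deformed multiplication `X∙Y = XY + λ(X∘Y)` with `X∘Y = (aX − Xa)(bY − Yb)`. -/
noncomputable def dotProd (a b : Matrix (Fin 2) (Fin 2) ℂ) (lam : ℂ) (X Y : Matrix (Fin 2) (Fin 2) ℂ) :
    Matrix (Fin 2) (Fin 2) ℂ :=
  X * Y + lam • circProd a b X Y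

/-- The commutator of a 2×2 matrix `a` with anything anticommutes with `a` up to the trace of `a`,
by Cayley–Hamilton. -/
theorem mul_commutator_add_commutator_mul (a X : Matrix (Fin 2) (Fin 2) ℂ) :
    a * (a * X - X * a) + (a * X - X * a) * a = a.trace • (a * X - X * a) := by
  ext i j
  fin_cases i <;> fin_cases j <;>
    simp [Matrix.mul_apply, Fin.sum_univ_two, Matrix.trace_fin_two] <;> ring

/-- Polarized Cayley–Hamilton: `ab + ba - tr(a) b - tr(b) a` is central. -/
theorem commutator_polarized_cayley_hamilton (a b Y : Matrix (Fin 2) (Fin 2) ℂ) :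
    (a * b + b * a) * Y - Y * (a * b + b * a) =
      a.trace • (b * Y - Y * b) + b.trace • (a * Y - Y * a) := by
  ext i j
  fin_cases i <;> fin_cases j <;>
    simp [Matrix.mul_apply, Fin.sum_univ_two, Matrix.trace_fin_two] <;> ring

theorem circProd_assoc (a b X Y Z : Matrix (Fin 2) (Fin 2) ℂ) :
    circProd a b (circProd a b X Y) Z = circProd a b X (circProd a b Y Z) := by
  have hX := mul_commutator_add_commutator_mul a X
  have hZ := mul_commutator_add_commutator_mul b Z
  have hY := commutator_polarized_cayley_hamilton a b Y
  unfold circProd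
  generalize a * X - X * a = P at *
  generalize b * Z - Z * b = Q at *
  have hP : a * P = a.trace • P - P * a := eq_sub_of_add_eq hX
  have hQ : Q * b = b.trace • Q - b * Q := eq_sub_of_add_eq' hZ
  have h_mid : a.trace • (b * Y - Y * b) - a * (b * Y - Y * b) - (b * Y - Y * b) * a
      - b * (a * Y - Y * a) - (a * Y - Y * a) * b + b.trace • (a * Y - Y * a) = 0 := by
    linear_combination (norm := noncomm_ring) -hY
  have h_diff : (a * (P * (b * Y - Y * b)) - P * (b * Y - Y * b) * a) * Q
      - P * (b * ((a * Y - Y * a) * Q) - (a * Y - Y * a) * Q * b)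
      = P * (a.trace • (b * Y - Y * b) - a * (b * Y - Y * b) - (b * Y - Y * b) * a
      - b * (a * Y - Y * a) - (a * Y - Y * a) * b + b.trace • (a * Y - Y * a)) * Q := by
    rw [← mul_assoc a P, hP, mul_assoc _ Q b, hQ]
    simp only [sub_mul, mul_sub, add_mul, mul_add, smul_mul_assoc, mul_smul_comm, smul_sub,
      mul_assoc]
    abel
  rw [← sub_eq_zero, h_diff, h_mid, mul_zero, zero_mul]

/-- The cocycle identity expressing compatibility of `∘` with the matrix product. -/
theorem circProd_mul_add (a b X Y Z : Matrix (Fin 2) (Fin 2) ℂ) :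
    circProd a b (X * Y) Z + circProd a b X Y * Z =
      circProd a b X (Y * Z) + X * circProd a b Y Z := by
  unfold circProd
  noncomm_ring

/-- For any `a, b ∈ Mat₂(ℂ)` the product `X∘Y = (aX − Xa)(bY − Yb)` is compatible with the
standard matrix product: `X∙Y = XY + λ(X∘Y)` is associative for every `λ ∈ ℂ`. -/
theorem stmt_16 (a b : Matrix (Fin 2) (Fin 2) ℂ) :
    ∀ (lam : ℂ) (X Y Z : Matrix (Fin 2) (Fin 2) ℂ),
      dotProd a b lam (dotProd a b lam X Y) Z = dotProd a b lam X (dotProd a b lam Y Z) := by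
  intro lam X Y Z
  have add_smul_left (U V W : Matrix (Fin 2) (Fin 2) ℂ) :
      circProd a b (U + lam • V) W = circProd a b U W + lam • circProd a b V W := by
    simp only [circProd, mul_add, add_mul, sub_mul, mul_sub, smul_mul_assoc, mul_smul_comm,
      smul_sub]
    abel
  have add_smul_right (U V W : Matrix (Fin 2) (Fin 2) ℂ) :
      circProd a b U (V + lam • W) = circProd a b U V + lam • circProd a b U W := by
    simp only [circProd, mul_add, add_mul, sub_mul, mul_sub, smul_mul_assoc, mul_smul_comm,
      smul_sub]
    abel
  have h := congrArg (lam • ·) (circProd_mul_add a b X Y Z)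
  simp only [smul_add] at h
  simp only [dotProd, add_smul_left, add_smul_right, circProd_assoc, add_mul, mul_add,
    smul_mul_assoc, mul_smul_comm, smul_add, mul_assoc]
  linear_combination (norm := abel) h
end

section
/- Let m ≥ 2, N ≥ 1 and let b^γ_{αβ} (α, β, γ ∈ {1,…,N}) be complex constants. On the polynomial algebra in the N·m² variables x^j_{i,α} (i, j ∈ {1,…,m}, α ∈ {1,…,N}), define the skew-symmetric biderivation bracket determined on generators by {x^j_{i,α}, x^{j'}_{i',β}} = Σ_γ b^γ_{αβ} x^{j'}_{i,γ} δ^j_{i'} − Σ_γ b^γ_{βα} x^j_{i',γ} δ^{j'}_i, extended to all polynomials by {f, g} = Σ_{u,v} {x_u, x_v} (∂f/∂x_u)(∂g/∂x_v). Then this bracket satisfies the Jacobi identity (i.e. is a Poisson bracket) if and only if b^μ_{αβ} b^σ_{μγ} = b^σ_{αμ} b^μ_{βγ} (summation over the repeated index μ) for all α, β, γ, σ, i.e. iff the b^γ_{αβ} are the structure constants of an associative algebra. -/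
open MvPolynomial

/-- The value of the linear trace bracket on a pair of generators:
`{x^j_{i,α}, x^{j'}_{i',β}} = Σ_γ b^γ_{αβ} x^{j'}_{i,γ} δ^j_{i'} − Σ_γ b^γ_{βα} x^j_{i',γ} δ^{j'}_i`,
where the variable `x^j_{i,α}` is encoded as the index `(i, j, α)`. -/
noncomputable def genBracket {m N : ℕ} (b : Fin N → Fin N → Fin N → ℂ)
    (u v : Fin m × Fin m × Fin N) : MvPolynomial (Fin m × Fin m × Fin N) ℂ :=
  (if u.2.1 = v.1 then
      ∑ γ : Fin N, C (b γ u.2.2 v.2.2) * X (u.1, v.2.1, γ) else 0)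
  - (if v.2.1 = u.1 then
      ∑ γ : Fin N, C (b γ v.2.2 u.2.2) * X (v.1, u.2.1, γ) else 0)

/-- The biderivation extension of the bracket on generators:
`{f, g} = Σ_{u,v} {x_u, x_v} (∂f/∂x_u)(∂g/∂x_v)`. -/
noncomputable def traceBracket {m N : ℕ} (b : Fin N → Fin N → Fin N → ℂ)
    (f g : MvPolynomial (Fin m × Fin m × Fin N) ℂ) :
    MvPolynomial (Fin m × Fin m × Fin N) ℂ :=
  ∑ u : Fin m × Fin m × Fin N, ∑ v : Fin m × Fin m × Fin N,
    genBracket b u v * pderiv u f * pderiv v g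

section Bracket

variable {m N : ℕ} (b : Fin N → Fin N → Fin N → ℂ)

/-- The Hamiltonian derivation `{f, ·}`. -/
noncomputable def hamDerivation (f : MvPolynomial (Fin m × Fin m × Fin N) ℂ) :
    Derivation ℂ (MvPolynomial (Fin m × Fin m × Fin N) ℂ)
      (MvPolynomial (Fin m × Fin m × Fin N) ℂ) :=
  ∑ u, ∑ v, (genBracket b u v * pderiv u f) • pderiv v

theorem hamDerivation_apply (f g : MvPolynomial (Fin m × Fin m × Fin N) ℂ) :
    hamDerivation b f g = traceBracket b f g := by
  simp only [hamDerivation, traceBracket, ← Derivation.coeFnAddMonoidHom_apply, map_sum,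
    Finset.sum_apply]
  simp

theorem genBracket_skew (u v : Fin m × Fin m × Fin N) :
    genBracket b u v = -genBracket b v u := by
  simp [genBracket]

theorem traceBracket_skew (f g : MvPolynomial (Fin m × Fin m × Fin N) ℂ) :
    traceBracket b f g = -traceBracket b g f := by
  unfold traceBracket
  rw [Finset.sum_comm, ← Finset.sum_neg_distrib]
  refine Finset.sum_congr rfl fun v _ => ?_
  rw [← Finset.sum_neg_distrib]
  refine Finset.sum_congr rfl fun u _ => ?_
  rw [genBracket_skew]
  ring

theorem traceBracket_X_X (u v : Fin m × Fin m × Fin N) :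
    traceBracket b (X u) (X v) = genBracket b u v := by
  simp [traceBracket, pderiv_X, Pi.single_apply]

/-- The cyclic sum whose vanishing is the Jacobi identity. -/
noncomputable def jacobiator (f g h : MvPolynomial (Fin m × Fin m × Fin N) ℂ) :
    MvPolynomial (Fin m × Fin m × Fin N) ℂ :=
  traceBracket b (traceBracket b f g) h + traceBracket b (traceBracket b g h) f
    + traceBracket b (traceBracket b h f) g

theorem jacobiator_rotate (f g h : MvPolynomial (Fin m × Fin m × Fin N) ℂ) :
    jacobiator b f g h = jacobiator b g h f := by
  unfold jacobiator
  ring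

theorem jacobiator_eq_derivation (f g h : MvPolynomial (Fin m × Fin m × Fin N) ℂ) :
    jacobiator b f g h =
      (hamDerivation b (traceBracket b f g) - ⁅hamDerivation b f, hamDerivation b g⁆) h := by
  rw [Derivation.sub_apply, Derivation.commutator_apply, jacobiator,
    traceBracket_skew b (traceBracket b g h) f, traceBracket_skew b (traceBracket b h f) g,
    traceBracket_skew b h f]
  simp only [← hamDerivation_apply, map_neg]
  ring

theorem jacobiator_eq_zero_of_X {f g : MvPolynomial (Fin m × Fin m × Fin N) ℂ}
    (H : ∀ w, jacobiator b f g (X w) = 0) (h : MvPolynomial (Fin m × Fin m × Fin N) ℂ) :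
    jacobiator b f g h = 0 := by
  simp only [jacobiator_eq_derivation] at H ⊢
  rw [derivation_eq_zero_of_forall_mem_vars fun w _ => H w]

theorem jacobiator_eq_zero_of_X_X_X
    (H : ∀ u v w : Fin m × Fin m × Fin N, jacobiator b (X u) (X v) (X w) = 0)
    (f g h : MvPolynomial (Fin m × Fin m × Fin N) ℂ) : jacobiator b f g h = 0 := by
  refine jacobiator_eq_zero_of_X b (fun w => ?_) h
  rw [← jacobiator_rotate]
  refine jacobiator_eq_zero_of_X b (fun v => ?_) g
  rw [← jacobiator_rotate]
  exact jacobiator_eq_zero_of_X b (fun u => H v w u) f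

/-- The product of three matrix units with coefficients in an algebra whose triple product
has structure constants `c`. -/
noncomputable def tripleProduct (c : Fin N → Fin N → Fin N → Fin N → ℂ)
    (u v w : Fin m × Fin m × Fin N) : MvPolynomial (Fin m × Fin m × Fin N) ℂ :=
  if u.2.1 = v.1 ∧ v.2.1 = w.1 then
    ∑ σ, C (c u.2.2 v.2.2 w.2.2 σ) * X (u.1, w.2.1, σ) else 0

/-- Structure constants of `(α * β) * γ`. -/
def leftAssocConst (α β γ σ : Fin N) : ℂ := ∑ μ, b μ α β * b σ μ γ

/-- Structure constants of `α * (β * γ)`. -/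
def rightAssocConst (α β γ σ : Fin N) : ℂ := ∑ μ, b σ α μ * b μ β γ

theorem traceBracket_sum_X (c : Fin N → ℂ) (i j : Fin m) (w : Fin m × Fin m × Fin N) :
    traceBracket b (∑ γ, C (c γ) * X (i, j, γ)) (X w)
      = ∑ γ, C (c γ) * genBracket b (i, j, γ) w := by
  rw [traceBracket_skew, ← hamDerivation_apply, map_sum, ← Finset.sum_neg_distrib]
  refine Finset.sum_congr rfl fun γ _ => ?_
  rw [← smul_eq_C_mul, Derivation.map_smul, hamDerivation_apply, traceBracket_X_X,
    genBracket_skew b w, smul_neg, neg_neg, smul_eq_C_mul]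

theorem sum_mul_genBracket (c : Fin N → ℂ) (i j : Fin m) (w : Fin m × Fin m × Fin N) :
    ∑ γ, C (c γ) * genBracket b (i, j, γ) w =
      (if j = w.1 then ∑ σ, C (∑ μ, c μ * b σ μ w.2.2) * X (i, w.2.1, σ) else 0)
      - (if w.2.1 = i then ∑ σ, C (∑ μ, b σ w.2.2 μ * c μ) * X (w.1, j, σ) else 0) := by
  simp only [genBracket, mul_sub, Finset.sum_sub_distrib, map_sum, Finset.sum_mul]
  congr 1
  · split_ifs
    · rw [Finset.sum_comm]
      simp only [Finset.mul_sum, C_mul, mul_assoc]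
    · simp
  · split_ifs
    · rw [Finset.sum_comm]
      refine Finset.sum_congr rfl fun σ _ => ?_
      rw [Finset.mul_sum]
      refine Finset.sum_congr rfl fun μ _ => ?_
      rw [C_mul]
      ring
    · simp

theorem traceBracket_genBracket_X (u v w : Fin m × Fin m × Fin N) :
    traceBracket b (genBracket b u v) (X w) =
      tripleProduct (leftAssocConst b) u v w - tripleProduct (rightAssocConst b) w u v
      - tripleProduct (leftAssocConst b) v u w + tripleProduct (rightAssocConst b) w v u := by
  have key (u v : Fin m × Fin m × Fin N) :
      traceBracket b (if u.2.1 = v.1 then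
        ∑ γ : Fin N, C (b γ u.2.2 v.2.2) * X (u.1, v.2.1, γ) else 0) (X w) =
      tripleProduct (leftAssocConst b) u v w - tripleProduct (rightAssocConst b) w u v := by
    by_cases huv : u.2.1 = v.1
    · rw [if_pos huv, traceBracket_sum_X, sum_mul_genBracket]
      simp [tripleProduct, huv, leftAssocConst, rightAssocConst]
    · simp [tripleProduct, huv, traceBracket]
  have hsub : traceBracket b (genBracket b u v) (X w) =
      traceBracket b (if u.2.1 = v.1 then
        ∑ γ : Fin N, C (b γ u.2.2 v.2.2) * X (u.1, v.2.1, γ) else 0) (X w) -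
      traceBracket b (if v.2.1 = u.1 then
        ∑ γ : Fin N, C (b γ v.2.2 u.2.2) * X (v.1, u.2.1, γ) else 0) (X w) := by
    simp only [genBracket, traceBracket_skew b _ (X w), ← hamDerivation_apply, map_sub]
    ring
  rw [hsub, key u v, key v u]
  ring

end Bracket

/-- The linear trace bracket on the entries of `N` matrices of size `m×m` (with `m ≥ 2`,
`N ≥ 1`) satisfies the Jacobi identity iff the constants `b^γ_{αβ}` are the structure
constants of an associative algebra. -/
theorem stmt_17 {m N : ℕ} (hm : 2 ≤ m) (hN : 1 ≤ N)
    (b : Fin N → Fin N → Fin N → ℂ) :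
    (∀ f g h : MvPolynomial (Fin m × Fin m × Fin N) ℂ,
      traceBracket b (traceBracket b f g) h + traceBracket b (traceBracket b g h) f
        + traceBracket b (traceBracket b h f) g = 0)
    ↔ (∀ α β γ σ : Fin N,
        ∑ μ : Fin N, b μ α β * b σ μ γ = ∑ μ : Fin N, b σ α μ * b μ β γ) := by
  constructor
  · intro H α β γ σ
    let i₀ : Fin m := ⟨0, by omega⟩
    let i₁ : Fin m := ⟨1, by omega⟩
    have h01 : i₀ ≠ i₁ := by simp [i₀, i₁]
    have J := H (X (i₁, i₀, α)) (X (i₀, i₀, β)) (X (i₀, i₁, γ))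
    simp only [traceBracket_X_X, traceBracket_genBracket_X] at J
    have J' := congrArg (coeff (Finsupp.single (i₁, i₁, σ) 1)) J
    simp [tripleProduct, h01, h01.symm, coeff_sum, coeff_C_mul, coeff_X,
      Finsupp.single_left_inj] at J'
    simpa [leftAssocConst, rightAssocConst, ← sub_eq_add_neg, sub_eq_zero] using J'
  · intro H
    have hc : leftAssocConst b = rightAssocConst b := by
      funext α β γ σ
      exact H α β γ σ
    refine jacobiator_eq_zero_of_X_X_X b fun u v w => ?_
    simp only [jacobiator, traceBracket_X_X, traceBracket_genBracket_X, hc]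
    ring
end

section
/- Let N and M be positive integers with M a proper divisor of N, and let λ₁,…,λ_N ∈ ℂ be pairwise distinct. Let 𝒜_{N,M} = { x ∈ Mat_N(ℂ) : Σ_{i ≡ r (mod M)} x_{ij} = 0 for every r = 1,…,M and every j = 1,…,N }. Then the skew-symmetric bilinear form (x, y) = tr((xy − yx)·diag(λ₁,…,λ_N)) is non-degenerate on 𝒜_{N,M}: if x ∈ 𝒜_{N,M} satisfies (x, y) = 0 for all y ∈ 𝒜_{N,M}, then x = 0. -/
open Polynomial in
/-- Injectivity of a Cauchy matrix whose nodes `v b` (`b ∈ s`) and `v a` (`a ∈ t`) are distinct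
and which has at least as many equations as unknowns. -/
theorem eq_zero_of_sum_div_sub_eq_zero {ι K : Type*} [DecidableEq ι] [Field K] {v : ι → K}
    (hv : Function.Injective v) {s t : Finset ι} (hst : Disjoint s t) (hcard : s.card ≤ t.card)
    (c : ι → K) (hc : ∀ a ∈ t, ∑ b ∈ s, c b / (v b - v a) = 0) : ∀ b ∈ s, c b = 0 := by
  intro b hb
  set P : K[X] := ∑ b ∈ s, C (c b) * ∏ b' ∈ s.erase b, (X - C (v b')) with hP
  have hdeg : P.degree < t.card := by
    refine (degree_sum_le _ _).trans_lt ((Finset.sup_lt_iff (by simp)).2 fun i hi => ?_)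
    refine ((degree_mul_le _ _).trans (add_le_add_left degree_C_le _)).trans_lt ?_
    rw [zero_add, degree_prod]
    simp only [degree_X_sub_C, Finset.sum_const, nsmul_eq_mul, mul_one]
    exact_mod_cast (Finset.card_erase_lt_of_mem hi).trans_le hcard
  have heval : ∀ a ∈ t, P.eval (v a) = 0 := by
    intro a ha
    have hne : ∀ i ∈ s, v a - v i ≠ 0 := fun i hi =>
      sub_ne_zero.2 (hv.ne (Finset.disjoint_left.1 hst.symm ha <| · ▸ hi))
    have key : P.eval (v a) = -(∏ i ∈ s, (v a - v i)) * ∑ b ∈ s, c b / (v b - v a) := by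
      rw [hP, eval_finsetSum, Finset.mul_sum]
      refine Finset.sum_congr rfl fun i hi => ?_
      rw [eval_mul, eval_C, eval_prod, ← Finset.mul_prod_erase s _ hi, ← neg_sub (v a) (v i)]
      simp only [eval_sub, eval_X, eval_C]
      have := hne i hi
      field_simp
    rw [key, hc a ha, mul_zero]
  have hP0 : P = 0 :=
    eq_zero_of_degree_lt_of_eval_index_eq_zero t hv.injOn hdeg heval
  have hb0 : P.eval (v b) = c b * ∏ i ∈ s.erase b, (v b - v i) := by
    rw [hP, eval_finsetSum, Finset.sum_eq_single b]
    · simp [eval_prod]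
    · intro i _ hib
      rw [eval_mul, eval_prod,
        Finset.prod_eq_zero (Finset.mem_erase.2 ⟨hib.symm, hb⟩) (by simp), mul_zero]
    · exact fun h => absurd hb h
  rw [hP0, eval_zero, eq_comm, mul_eq_zero] at hb0
  refine hb0.resolve_right (Finset.prod_ne_zero_iff.2 fun i hi => ?_)
  exact sub_ne_zero.2 (hv.ne (Finset.ne_of_mem_erase hi).symm)

/-- If `M ∣ N`, no residue class modulo `M` in `Fin N` is larger than another. -/
theorem Fin.card_filter_mod_le {N M : ℕ} (hdvd : M ∣ N) (r s : Fin M) :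
    (Finset.univ.filter fun i : Fin N => (i : ℕ) % M = r).card ≤
      (Finset.univ.filter fun i : Fin N => (i : ℕ) % M = s).card := by
  obtain ⟨k, rfl⟩ := hdvd
  have hlt : ∀ i : Fin (M * k), M * ((i : ℕ) / M) + s < M * k := fun i => by
    have h1 : (i : ℕ) / M + 1 ≤ k := Nat.div_lt_of_lt_mul i.2
    have h2 := Nat.mul_le_mul_left M h1
    have h3 := s.2
    rw [mul_add, mul_one] at h2
    omega
  refine Finset.card_le_card_of_injOn (fun i => ⟨M * ((i : ℕ) / M) + s, hlt i⟩) ?_ ?_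
  · intro i _
    simp [Nat.mod_eq_of_lt s.2]
  · intro i hi j hj hij
    simp only [Finset.coe_filter, Finset.mem_univ, true_and, Set.mem_ofPred_eq] at hi hj
    have h1 : M * ((i : ℕ) / M) = M * ((j : ℕ) / M) := by simpa using hij
    apply Fin.ext
    rw [← Nat.div_add_mod (i : ℕ) M, ← Nat.div_add_mod (j : ℕ) M, h1, hi, hj]

theorem Matrix.trace_commutator_single_mul_diagonal {n R : Type*} [Fintype n] [DecidableEq n]
    [CommRing R] (x : Matrix n n R) (d : n → R) (a b : n) :
    Matrix.trace ((x * Matrix.single a b 1 - Matrix.single a b 1 * x) * Matrix.diagonal d) =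
      (d b - d a) * x b a := by
  rw [sub_mul, Matrix.trace_sub, mul_assoc, Matrix.trace_mul_comm, mul_assoc, mul_assoc,
    Matrix.trace_single_mul, Matrix.trace_single_mul]
  simp
  ring


/-- Non-degeneracy of the anti-Frobenius form on `𝒜_{N,M}`: for `M` a proper divisor of `N`
and pairwise distinct `λ₁,…,λ_N`, if `x ∈ 𝒜_{N,M}` pairs trivially (via
`(x,y) = tr([x,y]·diag(λ))`) with every `y ∈ 𝒜_{N,M}`, then `x = 0`. -/
theorem stmt_18 {N M : ℕ} (hMpos : 0 < M) (hdvd : M ∣ N) (hne : M ≠ N)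
    (lam : Fin N → ℂ) (hlam : Function.Injective lam)
    (x : Matrix (Fin N) (Fin N) ℂ)
    (hx : ∀ (r : Fin M) (j : Fin N),
      ∑ i ∈ Finset.univ.filter (fun i : Fin N => (i : ℕ) % M = (r : ℕ)), x i j = 0)
    (h : ∀ y : Matrix (Fin N) (Fin N) ℂ,
      (∀ (r : Fin M) (j : Fin N),
        ∑ i ∈ Finset.univ.filter (fun i : Fin N => (i : ℕ) % M = (r : ℕ)), y i j = 0) →
      Matrix.trace ((x * y - y * x) * Matrix.diagonal lam) = 0) :
    x = 0 := by
  have hconst : ∀ a a' b : Fin N, (a : ℕ) % M = (a' : ℕ) % M →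
      (lam b - lam a) * x b a = (lam b - lam a') * x b a' := by
    intro a a' b haa
    have hy := h (Matrix.single a b 1 - Matrix.single a' b 1) fun r j => by
      by_cases hj : b = j
      · simp [Matrix.single_apply, hj, Finset.sum_sub_distrib, haa]
      · simp [hj]
    rw [← sub_eq_zero, ← hy, ← Matrix.trace_commutator_single_mul_diagonal,
      ← Matrix.trace_commutator_single_mul_diagonal, ← Matrix.trace_sub, ← sub_mul]
    congr 2
    noncomm_ring
  have hsame : ∀ a b : Fin N, a ≠ b → (a : ℕ) % M = (b : ℕ) % M → x b a = 0 := by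
    intro a b hab hmod
    have := hconst a b b hmod
    rw [sub_self, zero_mul, mul_eq_zero, sub_eq_zero] at this
    exact this.resolve_left (hlam.ne hab.symm)
  ext b a
  rw [Matrix.zero_apply]
  have hr := Nat.mod_lt (b : ℕ) hMpos
  by_cases hmod : (a : ℕ) % M = (b : ℕ) % M
  · by_cases hab : a = b
    · subst hab
      have := hx ⟨_, hr⟩ a
      rwa [Finset.sum_eq_single_of_mem a (by simp)] at this
      intro i hi hia
      exact hsame a i hia.symm (Finset.mem_filter.1 hi).2.symm
    · exact hsame a b hab hmod
  · have hzero := eq_zero_of_sum_div_sub_eq_zero hlam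
      (Finset.disjoint_left.2 fun i hi hi' => hmod <|
        (Finset.mem_filter.1 hi').2.symm.trans (Finset.mem_filter.1 hi).2)
      (Fin.card_filter_mod_le hdvd ⟨_, hr⟩ ⟨_, Nat.mod_lt (a : ℕ) hMpos⟩)
      (fun i => (lam i - lam a) * x i a) (fun a' ha' => by
        rw [← hx ⟨_, hr⟩ a']
        refine Finset.sum_congr rfl fun i hi => ?_
        have hmod' := (Finset.mem_filter.1 ha').2
        have hne' : lam i - lam a' ≠ 0 := sub_ne_zero.2 <| hlam.ne fun hia => hmod <|
          hmod'.symm.trans (hia ▸ (Finset.mem_filter.1 hi).2)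
        rw [hconst a a' i hmod'.symm, mul_div_cancel_left₀ _ hne'])
      b (by simp)
    refine (mul_eq_zero.1 hzero).resolve_left (sub_ne_zero.2 (hlam.ne fun hba => hmod ?_))
    rw [hba]
end
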